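/- arXiv:2410.10990 — 7 statements merged into one kernel-verified Lean document; each statement's English description precedes it below -/
import Mathlib

section
/- Let R be a commutative Noetherian ring of prime characteristic p > 0, let I, 𝔞 ⊆ R be ideals, and let t > 0 be a real number. Then: (a) I^F ⊆ ^{𝔞ᵗ}I^F ⊆ I^{F𝔞ᵗ}; (b) both ^{𝔞ᵗ}I^F and I^{F𝔞ᵗ} are ideals of R; and (c) the Vraciu 𝔞ᵗ-Frobenius closure is idempotent: ^{𝔞ᵗ}(^{𝔞ᵗ}I^F)^F = ^{𝔞ᵗ}I^F. -/
open Ideal Filter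
open scoped Pointwise

/-- `R°`: the set of elements of `R` not contained in any minimal prime of `R`. -/
def Rcirc (R : Type*) [CommRing R] : Set R :=
  {c | ∀ P ∈ minimalPrimes R, c ∉ P}

/-- The integral closure of an ideal `I`: elements satisfying an equation
`x^n + r₁ x^{n-1} + ⋯ + rₙ = 0` with `rᵢ ∈ Iⁱ`. -/
def intCl {R : Type*} [CommRing R] (I : Ideal R) : Set R :=
  {x | ∃ n : ℕ, 0 < n ∧ ∃ r : ℕ → R,
    (∀ i, 1 ≤ i → i ≤ n → r i ∈ I ^ i) ∧
    x ^ n + ∑ i ∈ Finset.range n, r (i + 1) * x ^ (n - (i + 1)) = 0}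

/-- The Hara–Yoshida `𝔞^t`-integral closure of `I`. -/
def HYIntCl {R : Type*} [CommRing R] (I a : Ideal R) (t : ℝ) : Set R :=
  {x | ∃ c ∈ Rcirc R, ∃ N : ℕ, ∀ n : ℕ, N ≤ n →
    ∀ y ∈ a ^ ⌈t * (n : ℝ)⌉₊, c * x ^ n * y ∈ I ^ n}

/-- The Vraciu `𝔞^t`-integral closure of `I`. -/
def VIntCl {R : Type*} [CommRing R] (I a : Ideal R) (t : ℝ) : Set R :=
  {x | ∃ c ∈ Rcirc R, ∃ N : ℕ, ∀ n : ℕ, N ≤ n →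
    ∀ y ∈ a ^ ⌈t * (n : ℝ)⌉₊, c * x ^ n * y ∈ a ^ ⌈t * (n : ℝ)⌉₊ * I ^ n}

/-- The `q`-th Frobenius bracket power `I^{[q]}`: the ideal generated by `q`-th powers
of elements of `I`. -/
def fbp {R : Type*} [CommRing R] (I : Ideal R) (q : ℕ) : Ideal R :=
  Ideal.span ((fun x => x ^ q) '' (I : Set R))

/-- The Frobenius closure `I^F` (in characteristic `p`). -/
def frobCl {R : Type*} [CommRing R] (p : ℕ) (I : Ideal R) : Set R :=
  {x | ∃ e : ℕ, x ^ p ^ e ∈ fbp I (p ^ e)}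

/-- The tight closure `I^*` (in characteristic `p`). -/
def tightCl {R : Type*} [CommRing R] (p : ℕ) (I : Ideal R) : Set R :=
  {x | ∃ c ∈ Rcirc R, ∃ E : ℕ, ∀ e : ℕ, E ≤ e → c * x ^ p ^ e ∈ fbp I (p ^ e)}

/-- The Hara–Yoshida `𝔞^t`-Frobenius closure of `I`. -/
def HYFrobCl {R : Type*} [CommRing R] (p : ℕ) (I a : Ideal R) (t : ℝ) : Set R :=
  {x | ∃ E : ℕ, ∀ e : ℕ, E ≤ e →
    ∀ y ∈ a ^ ⌈t * (p : ℝ) ^ e⌉₊, x ^ p ^ e * y ∈ fbp I (p ^ e)}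

/-- The Vraciu `𝔞^t`-Frobenius closure of `I`. -/
def VFrobCl {R : Type*} [CommRing R] (p : ℕ) (I a : Ideal R) (t : ℝ) : Set R :=
  {x | ∃ E : ℕ, ∀ e : ℕ, E ≤ e →
    ∀ y ∈ a ^ ⌈t * (p : ℝ) ^ e⌉₊, x ^ p ^ e * y ∈ a ^ ⌈t * (p : ℝ) ^ e⌉₊ * fbp I (p ^ e)}

/-- The Hara–Yoshida `𝔞^t`-tight closure of `I`. -/
def HYTightCl {R : Type*} [CommRing R] (p : ℕ) (I a : Ideal R) (t : ℝ) : Set R :=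
  {x | ∃ c ∈ Rcirc R, ∃ E : ℕ, ∀ e : ℕ, E ≤ e →
    ∀ y ∈ a ^ ⌈t * (p : ℝ) ^ e⌉₊, c * x ^ p ^ e * y ∈ fbp I (p ^ e)}

/-- The Vraciu `𝔞^t`-tight closure of `I`. -/
def VTightCl {R : Type*} [CommRing R] (p : ℕ) (I a : Ideal R) (t : ℝ) : Set R :=
  {x | ∃ c ∈ Rcirc R, ∃ E : ℕ, ∀ e : ℕ, E ≤ e →
    ∀ y ∈ a ^ ⌈t * (p : ℝ) ^ e⌉₊, c * x ^ p ^ e * y ∈ a ^ ⌈t * (p : ℝ) ^ e⌉₊ * fbp I (p ^ e)}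

/-- The `t`-th rational power of an ideal `𝔞`, for `t = num/den ∈ ℚ`. -/
def ratPow {R : Type*} [CommRing R] (a : Ideal R) (t : ℚ) : Set R :=
  {x | x ^ t.den ∈ intCl (a ^ t.num.toNat)}

/-- `μ(𝔞)`: the minimal number of generators of the ideal `𝔞`. -/
noncomputable def mu {R : Type*} [CommRing R] (a : Ideal R) : ℕ :=
  sInf {m | ∃ s : Finset R, s.card = m ∧ Ideal.span (s : Set R) = a}

theorem fbp_eq_map {R : Type*} [CommRing R] (p : ℕ) [ExpChar R p] (I : Ideal R) (e : ℕ) :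
    fbp I (p ^ e) = I.map (iterateFrobenius R p e) :=
  rfl

theorem pow_mem_fbp {R : Type*} [CommRing R] {I : Ideal R} {x : R} (hx : x ∈ I) (q : ℕ) :
    x ^ q ∈ fbp I q :=
  Ideal.subset_span ⟨x, hx, rfl⟩

theorem fbp_mono {R : Type*} [CommRing R] {I J : Ideal R} (h : I ≤ J) (q : ℕ) :
    fbp I q ≤ fbp J q :=
  Ideal.span_mono (Set.image_mono h)

/-- Membership of a Frobenius power of `x` in the bracket power persists for larger exponents. -/
theorem pow_mem_fbp_of_le {R : Type*} [CommRing R] (p : ℕ) [ExpChar R p] {I : Ideal R} {x : R}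
    {d e : ℕ} (hde : d ≤ e) (hx : x ^ p ^ d ∈ fbp I (p ^ d)) : x ^ p ^ e ∈ fbp I (p ^ e) := by
  obtain ⟨k, rfl⟩ := Nat.exists_eq_add_of_le' hde
  have h := Ideal.mem_map_of_mem (iterateFrobenius R p k) hx
  rw [fbp_eq_map, Ideal.map_map, ← iterateFrobenius_add, iterateFrobenius_def, ← pow_mul,
    ← pow_add, add_comm] at h
  rwa [fbp_eq_map, add_comm k d]

/-- The elements whose large Frobenius powers multiply `A e` into `K e` form an ideal. -/
def eventualFrobeniusColon {R : Type*} [CommRing R] (p : ℕ) [ExpChar R p] (A K : ℕ → Ideal R) :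
    Ideal R where
  carrier := {x | ∃ E : ℕ, ∀ e : ℕ, E ≤ e → ∀ y ∈ A e, x ^ p ^ e * y ∈ K e}
  zero_mem' := ⟨0, fun e _ y _ => by
    rw [zero_pow (pow_ne_zero e (expChar_pos R p).ne'), zero_mul]
    exact zero_mem _⟩
  add_mem' := by
    rintro x z ⟨E, hx⟩ ⟨F, hz⟩
    refine ⟨max E F, fun e he y hy => ?_⟩
    rw [add_pow_expChar_pow, add_mul]
    exact add_mem (hx e (le_of_max_le_left he) y hy) (hz e (le_of_max_le_right he) y hy)
  smul_mem' := by
    rintro c x ⟨E, hx⟩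
    refine ⟨E, fun e he y hy => ?_⟩
    rw [smul_eq_mul, mul_pow, mul_assoc]
    exact Ideal.mul_mem_left _ _ (hx e he y hy)

theorem frobCl_subset_VFrobCl {R : Type*} [CommRing R] (p : ℕ) [ExpChar R p] (I a : Ideal R)
    (t : ℝ) : frobCl p I ⊆ VFrobCl p I a t := by
  rintro x ⟨d, hx⟩
  refine ⟨d, fun e he y hy => ?_⟩
  rw [mul_comm _ y]
  exact Ideal.mul_mem_mul hy (pow_mem_fbp_of_le p he hx)

theorem VFrobCl_subset_HYFrobCl {R : Type*} [CommRing R] (p : ℕ) (I a : Ideal R) (t : ℝ) :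
    VFrobCl p I a t ⊆ HYFrobCl p I a t := by
  rintro x ⟨E, hx⟩
  exact ⟨E, fun e he y hy => Ideal.mul_le_right (hx e he y hy)⟩

theorem subset_frobCl {R : Type*} [CommRing R] (p : ℕ) (I : Ideal R) :
    (I : Set R) ⊆ frobCl p I :=
  fun _ hx => ⟨0, pow_mem_fbp hx _⟩

theorem VFrobCl_mono {R : Type*} [CommRing R] (p : ℕ) {I J : Ideal R} (h : I ≤ J) (a : Ideal R)
    (t : ℝ) : VFrobCl p I a t ⊆ VFrobCl p J a t := by
  rintro x ⟨E, hx⟩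
  exact ⟨E, fun e he y hy => Ideal.mul_mono_right (fbp_mono h _) (hx e he y hy)⟩

/-- A finitely generated ideal inside the Vraciu closure of `I` admits a uniform exponent bound. -/
theorem exists_mul_fbp_le_of_subset_VFrobCl {R : Type*} [CommRing R] (p : ℕ) [ExpChar R p]
    {I J a : Ideal R} {t : ℝ} (hfg : J.FG) (hJ : (J : Set R) ⊆ VFrobCl p I a t) :
    ∃ E : ℕ, ∀ e : ℕ, E ≤ e →
      a ^ ⌈t * (p : ℝ) ^ e⌉₊ * fbp J (p ^ e) ≤ a ^ ⌈t * (p : ℝ) ^ e⌉₊ * fbp I (p ^ e) := by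
  obtain ⟨s, rfl⟩ := hfg
  have hs : ∀ g ∈ s, g ∈ VFrobCl p I a t := fun g hg => hJ (Ideal.subset_span hg)
  choose! E hE using hs
  refine ⟨s.sup E, fun e he => ?_⟩
  rw [fbp_eq_map p (Ideal.span _), Ideal.map_span, Ideal.mul_le]
  intro y hy z hz
  induction hz using Submodule.span_induction with
  | mem z hz =>
    obtain ⟨g, hg, rfl⟩ := hz
    rw [iterateFrobenius_def, mul_comm y]
    exact hE g hg e ((Finset.le_sup hg).trans he) y hy
  | zero => simp
  | add z w _ _ hz hw => rw [mul_add]; exact add_mem hz hw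
  | smul c z _ hz => rw [smul_eq_mul, mul_left_comm]; exact Ideal.mul_mem_left _ c hz

theorem VFrobCl_eq_of_coe_eq_VFrobCl {R : Type*} [CommRing R] (p : ℕ) [ExpChar R p]
    {I J a : Ideal R} {t : ℝ} (hfg : J.FG) (hJ : (J : Set R) = VFrobCl p I a t) :
    VFrobCl p J a t = VFrobCl p I a t := by
  apply Set.Subset.antisymm
  · rintro x ⟨E, hx⟩
    obtain ⟨F, hF⟩ := exists_mul_fbp_le_of_subset_VFrobCl p hfg hJ.subset
    exact ⟨max E F, fun e he y hy =>
      hF e (le_of_max_le_right he) (hx e (le_of_max_le_left he) y hy)⟩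
  · refine VFrobCl_mono p (fun x hx => ?_) a t
    rw [← SetLike.mem_coe, hJ]
    exact frobCl_subset_VFrobCl p I a t (subset_frobCl p I hx)

theorem adjusted_frobenius_closures_basics {R : Type*} [CommRing R] [IsNoetherianRing R]
    (p : ℕ) [Fact p.Prime] [CharP R p] (I a : Ideal R) (t : ℝ) (ht : 0 < t) :
    (frobCl p I ⊆ VFrobCl p I a t ∧ VFrobCl p I a t ⊆ HYFrobCl p I a t) ∧
    ((∃ J : Ideal R, (J : Set R) = VFrobCl p I a t) ∧
      (∃ J : Ideal R, (J : Set R) = HYFrobCl p I a t)) ∧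
    (∀ J : Ideal R, (J : Set R) = VFrobCl p I a t →
      VFrobCl p J a t = VFrobCl p I a t) := by
  exact ⟨⟨frobCl_subset_VFrobCl p I a t, VFrobCl_subset_HYFrobCl p I a t⟩,
    ⟨⟨eventualFrobeniusColon p (fun e => a ^ ⌈t * (p : ℝ) ^ e⌉₊)
        (fun e => a ^ ⌈t * (p : ℝ) ^ e⌉₊ * fbp I (p ^ e)), rfl⟩,
      ⟨eventualFrobeniusColon p (fun e => a ^ ⌈t * (p : ℝ) ^ e⌉₊)
        (fun e => fbp I (p ^ e)), rfl⟩⟩,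
    fun J hJ => VFrobCl_eq_of_coe_eq_VFrobCl p (IsNoetherian.noetherian J) hJ⟩
end

section
/- Let R be a commutative Noetherian ring of prime characteristic p > 0 and let I, 𝔞 ⊆ R be ideals. Then: (a) I^{F𝔞} ⊆ (I^F : 𝔞), and if 𝔞 = (f) is principal then I^{F(f)} = (I^F : (f)); (b) if 𝔞 = (f) is principal and f is a nonzerodivisor on R, then for every real t > 0 the Vraciu 𝔞ᵗ-Frobenius closure satisfies ^{(f)ᵗ}I^F = I^F. -/
open Ideal Filter
open scoped Pointwise

theorem pow_mem_fbp_mul {R : Type*} [CommRing R] (p : ℕ) [Fact p.Prime] [CharP R p]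
    {I : Ideal R} {q : ℕ} {z : R} (hz : z ∈ fbp I q) (k : ℕ) :
    z ^ p ^ k ∈ fbp I (q * p ^ k) := by
  unfold fbp at hz
  induction hz using Submodule.span_induction with
  | mem z hz =>
    obtain ⟨w, hw, rfl⟩ := hz
    refine Ideal.subset_span ⟨w, hw, ?_⟩
    simp only [pow_mul]
  | zero =>
    rw [zero_pow (pow_ne_zero k (Fact.out : p.Prime).ne_zero)]
    exact Ideal.zero_mem _
  | add u v _ _ hu hv =>
    rw [add_pow_char_pow]
    exact Ideal.add_mem _ hu hv
  | smul r u _ hu =>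
    rw [smul_eq_mul, mul_pow]
    exact Ideal.mul_mem_left _ _ hu

theorem frobCl_eventually {R : Type*} [CommRing R] (p : ℕ) [Fact p.Prime] [CharP R p]
    {I : Ideal R} {x : R} (hx : x ∈ frobCl p I) :
    ∃ E : ℕ, ∀ e : ℕ, E ≤ e → x ^ p ^ e ∈ fbp I (p ^ e) := by
  obtain ⟨E, hE⟩ := hx
  refine ⟨E, fun e he => ?_⟩
  obtain ⟨k, rfl⟩ := Nat.exists_eq_add_of_le he
  rw [pow_add, pow_mul]
  exact pow_mem_fbp_mul p hE k

theorem ceil_one_mul_natCast_pow (p e : ℕ) : ⌈(1 : ℝ) * (p : ℝ) ^ e⌉₊ = p ^ e := by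
  rw [one_mul, ← Nat.cast_pow, Nat.ceil_natCast]

theorem HYFrobCl_one_subset {R : Type*} [CommRing R] (p : ℕ) (I a : Ideal R) :
    HYFrobCl p I a 1 ⊆ {x | ∀ y ∈ a, x * y ∈ frobCl p I} := by
  rintro x ⟨E, hE⟩ y hy
  refine ⟨E, ?_⟩
  rw [mul_pow]
  refine hE E le_rfl _ ?_
  rw [ceil_one_mul_natCast_pow]
  exact Ideal.pow_mem_pow hy _

theorem mem_of_mul_pow_mem_span_pow_mul {R : Type*} [CommRing R] {f : R}
    (hf : f ∈ nonZeroDivisors R) {n : ℕ} {J : Ideal R} {z : R}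
    (hz : z * f ^ n ∈ Ideal.span {f} ^ n * J) : z ∈ J := by
  rw [Ideal.span_singleton_pow, Ideal.mem_span_singleton_mul] at hz
  obtain ⟨w, hw, h⟩ := hz
  rw [mul_comm] at h
  rwa [← (mul_cancel_right_mem_nonZeroDivisors (pow_mem hf n)).mp h]

theorem adjusted_frobenius_closure_principal {R : Type*} [CommRing R] [IsNoetherianRing R]
    (p : ℕ) [Fact p.Prime] [CharP R p] (I : Ideal R) :
    (∀ a : Ideal R, HYFrobCl p I a 1 ⊆ {x | ∀ y ∈ a, x * y ∈ frobCl p I}) ∧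
    (∀ f : R, HYFrobCl p I (Ideal.span {f}) 1 =
      {x | ∀ y ∈ Ideal.span ({f} : Set R), x * y ∈ frobCl p I}) ∧
    (∀ f : R, f ∈ nonZeroDivisors R → ∀ t : ℝ, 0 < t →
      VFrobCl p I (Ideal.span {f}) t = frobCl p I) := by
  refine ⟨HYFrobCl_one_subset p I, fun f => (HYFrobCl_one_subset p I _).antisymm ?_, ?_⟩
  · intro x hx
    obtain ⟨E, hE⟩ := frobCl_eventually p (hx f (Ideal.mem_span_singleton_self f))
    refine ⟨E, fun e he y hy => ?_⟩
    rw [ceil_one_mul_natCast_pow, Ideal.span_singleton_pow, Ideal.mem_span_singleton] at hy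
    obtain ⟨w, rfl⟩ := hy
    rw [← mul_assoc, ← mul_pow]
    exact Ideal.mul_mem_right _ _ (hE e he)
  · intro f hf t _
    ext x
    constructor
    · rintro ⟨E, hE⟩
      exact ⟨E, mem_of_mul_pow_mem_span_pow_mul hf
        (hE E le_rfl _ (Ideal.pow_mem_pow (Ideal.mem_span_singleton_self f) _))⟩
    · intro hx
      obtain ⟨E, hE⟩ := frobCl_eventually p hx
      refine ⟨E, fun e he y hy => ?_⟩
      rw [mul_comm (x ^ p ^ e) y]
      exact Ideal.mul_mem_mul hy (hE e he)
end

section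
/- Let R be a commutative Noetherian ring of prime characteristic p > 0, let I, 𝔞 ⊆ R be ideals, and let t > μ(𝔞) be a real number, where μ(𝔞) is the minimal number of generators of 𝔞. Then: (i) I^{F𝔞ᵗ} = (I^{F𝔞^{t-1}} : 𝔞); and (ii) ^{𝔞ᵗ}I^F = (^{𝔞^{t-1}}(𝔞I)^F : 𝔞). -/
open Ideal Filter
open scoped Pointwise

theorem fbp_eq_map_iterateFrobenius {R : Type*} [CommRing R] (p : ℕ) [Fact p.Prime] [CharP R p]
    (I : Ideal R) (e : ℕ) : fbp I (p ^ e) = I.map (iterateFrobenius R p e) := by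
  rw [fbp, Ideal.map, funext (iterateFrobenius_def p e)]

theorem fbp_mul {R : Type*} [CommRing R] (p : ℕ) [Fact p.Prime] [CharP R p]
    (I J : Ideal R) (e : ℕ) : fbp (I * J) (p ^ e) = fbp I (p ^ e) * fbp J (p ^ e) := by
  simp only [fbp_eq_map_iterateFrobenius, Ideal.map_mul]

theorem fbp_le_pow {R : Type*} [CommRing R] (I : Ideal R) (q : ℕ) : fbp I q ≤ I ^ q := by
  rw [fbp, Ideal.span_le]
  rintro _ ⟨x, hx, rfl⟩
  exact Ideal.pow_mem_pow hx q

/-- A sufficiently high power of a finitely generated ideal factors through the `q`-th powers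
of the generators, by the pigeonhole principle. -/
theorem span_pow_le_mul_span_image_pow {R : Type*} [CommRing R] (s : Finset R) {q N : ℕ}
    (hq : 0 < q) (hN : s.card * (q - 1) < N) :
    Ideal.span (s : Set R) ^ N ≤
      Ideal.span (s : Set R) ^ (N - q) * Ideal.span ((fun x => x ^ q) '' (s : Set R)) := by
  classical
  conv_lhs => rw [Ideal.span, Submodule.span_pow]
  refine Submodule.span_le.2 fun x hx => ?_
  obtain ⟨f, rfl⟩ := Set.mem_pow.1 hx
  obtain ⟨z, hz⟩ := Fintype.exists_lt_card_fiber_of_mul_lt_card (n := q - 1) f (by simpa using hN)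
  set A := Finset.univ.filter fun i => f i = z with hA
  have hAN : A.card + Aᶜ.card = N := by rw [Finset.card_add_card_compl, Fintype.card_fin]
  have hprod : (List.ofFn fun i => (f i : R)).prod =
      ((z : R) ^ (A.card - q) * ∏ i ∈ Aᶜ, (f i : R)) * (z : R) ^ q := by
    rw [List.prod_ofFn, ← Finset.prod_mul_prod_compl A,
      Finset.prod_congr rfl (g := fun _ => (z : R)) fun i hi => by
        rw [(Finset.mem_filter.1 hi).2],
      Finset.prod_const, mul_right_comm, ← pow_add, Nat.sub_add_cancel (by omega)]
  have hmem : (z : R) ^ (A.card - q) * ∏ i ∈ Aᶜ, (f i : R) ∈ Ideal.span (s : Set R) ^ (N - q) := by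
    rw [show N - q = (A.card - q) + Aᶜ.card by omega, pow_add, ← Finset.prod_const]
    exact Ideal.mul_mem_mul (Ideal.pow_mem_pow (Ideal.subset_span z.2) _)
      (Ideal.prod_mem_prod fun i _ => Ideal.subset_span (f i).2)
  rw [SetLike.mem_coe, hprod]
  exact Ideal.mul_mem_mul hmem (Ideal.subset_span ⟨z, z.2, rfl⟩)

theorem exists_finset_card_eq_mu {R : Type*} [CommRing R] [IsNoetherianRing R] (a : Ideal R) :
    ∃ s : Finset R, s.card = mu a ∧ Ideal.span (s : Set R) = a := by
  obtain ⟨s, hs⟩ := IsNoetherian.noetherian a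
  exact Nat.sInf_mem (s := {m | ∃ s : Finset R, s.card = m ∧ Ideal.span (s : Set R) = a})
    ⟨s.card, s, rfl, hs⟩

theorem mul_sub_one_lt_ceil {m q : ℕ} {t : ℝ} (hq : 0 < q) (ht : (m : ℝ) < t) :
    m * (q - 1) < ⌈t * (q : ℝ)⌉₊ := by
  rw [Nat.lt_ceil]
  calc ((m * (q - 1) : ℕ) : ℝ) ≤ ((m * q : ℕ) : ℝ) := by gcongr; omega
    _ = m * q := by push_cast; rfl
    _ < t * q := by gcongr

theorem ceil_sub_one_mul (t : ℝ) (q : ℕ) : ⌈(t - 1) * (q : ℝ)⌉₊ = ⌈t * (q : ℝ)⌉₊ - q := by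
  rw [sub_mul, one_mul, Nat.ceil_sub_natCast]

theorem pow_sub_mul_pow_le {R : Type*} [CommRing R] (a : Ideal R) (N q : ℕ) :
    a ^ (N - q) * a ^ q ≤ a ^ N := by
  rw [← pow_add]
  exact Ideal.pow_le_pow_right (by omega)

/-- When `t` exceeds the number of generators of `a`, one factor `a` can be traded for a shift
of `t` by one, uniformly in the target ideals. -/
theorem eventually_mul_mem_iff {R : Type*} [CommRing R] [IsNoetherianRing R]
    (p : ℕ) [Fact p.Prime] (a : Ideal R) (t : ℝ) (ht : (mu a : ℝ) < t) (K : ℕ → Ideal R) (x : R) :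
    (∃ E : ℕ, ∀ e : ℕ, E ≤ e → ∀ y ∈ a ^ ⌈t * (p : ℝ) ^ e⌉₊, x ^ p ^ e * y ∈ K e) ↔
    ∀ z ∈ a, ∃ E : ℕ, ∀ e : ℕ, E ≤ e →
      ∀ y ∈ a ^ ⌈(t - 1) * (p : ℝ) ^ e⌉₊, (x * z) ^ p ^ e * y ∈ K e := by
  have hp (e : ℕ) : 0 < p ^ e := pow_pos (Fact.out : p.Prime).pos e
  simp only [← Nat.cast_pow, ceil_sub_one_mul]
  constructor
  · rintro ⟨E, hE⟩ z hz
    refine ⟨E, fun e he y hy => ?_⟩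
    rw [mul_pow, mul_assoc, mul_comm (z ^ _)]
    exact hE e he _ (pow_sub_mul_pow_le a _ _ (Ideal.mul_mem_mul hy (Ideal.pow_mem_pow hz _)))
  · intro h
    obtain ⟨s, hs, hsa⟩ := exists_finset_card_eq_mu a
    choose! E hE using h
    refine ⟨s.sup E, fun e he y hy => ?_⟩
    have hle := span_pow_le_mul_span_image_pow s (hp e)
      (hs ▸ mul_sub_one_lt_ceil (hp e) ht : s.card * (p ^ e - 1) < ⌈t * ((p ^ e : ℕ) : ℝ)⌉₊)
    rw [hsa] at hle
    suffices a ^ (⌈t * ((p ^ e : ℕ) : ℝ)⌉₊ - p ^ e) *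
        Ideal.span ((fun x => x ^ p ^ e) '' (s : Set R)) ≤
        Submodule.comap (LinearMap.mulLeft R (x ^ p ^ e)) (K e) from this (hle hy)
    rw [mul_comm, Ideal.mul_le]
    intro w hw v hv
    induction hw using Submodule.span_induction with
    | mem w hw =>
      obtain ⟨z, hz, rfl⟩ := hw
      have := hE z (hsa ▸ Ideal.subset_span hz) e ((Finset.le_sup hz).trans he) v hv
      simpa [mul_pow, mul_assoc] using this
    | zero => simp
    | add u w _ _ hu hw => rw [add_mul]; exact add_mem hu hw
    | smul r w _ hw => rw [smul_mul_assoc]; exact Submodule.smul_mem _ r hw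

theorem pow_mul_fbp_eq {R : Type*} [CommRing R] [IsNoetherianRing R]
    (p : ℕ) [Fact p.Prime] [CharP R p] (I a : Ideal R) (t : ℝ) (ht : (mu a : ℝ) < t) (e : ℕ) :
    a ^ ⌈t * (p : ℝ) ^ e⌉₊ * fbp I (p ^ e) =
      a ^ ⌈(t - 1) * (p : ℝ) ^ e⌉₊ * fbp (a * I) (p ^ e) := by
  have hp : 0 < p ^ e := pow_pos (Fact.out : p.Prime).pos e
  obtain ⟨s, hs, hsa⟩ := exists_finset_card_eq_mu a
  rw [fbp_mul, ← mul_assoc]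
  simp only [← Nat.cast_pow, ceil_sub_one_mul]
  congr 1
  refine le_antisymm ?_
    ((Ideal.mul_mono_right (fbp_le_pow a (p ^ e))).trans (pow_sub_mul_pow_le a _ _))
  have hle := span_pow_le_mul_span_image_pow s hp
    (hs ▸ mul_sub_one_lt_ceil hp ht : s.card * (p ^ e - 1) < ⌈t * ((p ^ e : ℕ) : ℝ)⌉₊)
  rw [hsa] at hle
  exact hle.trans (Ideal.mul_mono_right
    (Ideal.span_mono (Set.image_mono (hsa ▸ Ideal.subset_span))))

theorem adjusted_frobenius_closure_large_t {R : Type*} [CommRing R] [IsNoetherianRing R]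
    (p : ℕ) [Fact p.Prime] [CharP R p] (I a : Ideal R) (t : ℝ) (ht : (mu a : ℝ) < t) :
    HYFrobCl p I a t = {x | ∀ y ∈ a, x * y ∈ HYFrobCl p I a (t - 1)} ∧
    VFrobCl p I a t = {x | ∀ y ∈ a, x * y ∈ VFrobCl p (a * I) a (t - 1)} := by
  constructor
  · ext x
    exact eventually_mul_mem_iff p a t ht (fun e => fbp I (p ^ e)) x
  · ext x
    have := eventually_mul_mem_iff p a t ht
      (fun e => a ^ ⌈t * (p : ℝ) ^ e⌉₊ * fbp I (p ^ e)) x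
    simpa only [VFrobCl, Set.mem_ofPred_eq, ← pow_mul_fbp_eq p I a t ht] using this
end

section
/- Let R be a commutative Noetherian ring of prime characteristic p > 0, let I, 𝔞, 𝔟 ⊆ R be ideals with 𝔞 ∩ R° ≠ ∅, let 𝔟 ⊆ 𝔞 be a reduction of 𝔞 (i.e. there exists k ≥ 0 such that 𝔟^m·𝔞^k = 𝔞^{m+k} for all m ≥ 1), and let t > 0 be a real number. Then ^{𝔞ᵗ}I* = ^{𝔟ᵗ}I* and Ī^{𝔞ᵗ} = Ī^{𝔟ᵗ}. -/
open Ideal Filter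
open scoped Pointwise

theorem Rcirc.mul_mem {R : Type*} [CommRing R] {c d : R} (hc : c ∈ Rcirc R)
    (hd : d ∈ Rcirc R) : c * d ∈ Rcirc R := fun P hP h =>
  (hP.1.1.mem_or_mem h).elim (hc P hP) (hd P hP)

theorem Rcirc.pow_mem {R : Type*} [CommRing R] {d : R} (hd : d ∈ Rcirc R) (k : ℕ) :
    d ^ k ∈ Rcirc R := fun P hP h => hd P hP (hP.1.1.mem_of_pow_mem k h)

/-- If `b` is a reduction of `a` and `d ∈ a`, then a fixed power of `d` multiplies every
power of `a` into the corresponding power of `b`. -/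
theorem span_pow_mul_pow_le_of_reduction {R : Type*} [CommRing R] {a b : Ideal R} {k : ℕ}
    (hk : ∀ m : ℕ, 1 ≤ m → b ^ m * a ^ k = a ^ (m + k)) {d : R} (hd : d ∈ a) (m : ℕ) :
    Ideal.span {d ^ k} * a ^ m ≤ b ^ m := by
  rcases Nat.eq_zero_or_pos m with rfl | hm
  · simp
  · calc Ideal.span {d ^ k} * a ^ m ≤ a ^ k * a ^ m :=
          Ideal.mul_mono_left ((Ideal.span_singleton_le_iff_mem _).2 (Ideal.pow_mem_pow hd k))
      _ = b ^ m * a ^ k := by rw [hk m hm, ← pow_add, add_comm]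
      _ ≤ b ^ m := Ideal.mul_le_left

theorem adjusted_closures_reduction_invariant {R : Type*} [CommRing R] [IsNoetherianRing R]
    (p : ℕ) [Fact p.Prime] [CharP R p] (I a b : Ideal R)
    (ha : ∃ c ∈ Rcirc R, c ∈ a) (hba : b ≤ a)
    (hred : ∃ k : ℕ, ∀ m : ℕ, 1 ≤ m → b ^ m * a ^ k = a ^ (m + k))
    (t : ℝ) (ht : 0 < t) :
    VTightCl p I a t = VTightCl p I b t ∧ HYIntCl I a t = HYIntCl I b t := by
  obtain ⟨d, hd, hda⟩ := ha
  obtain ⟨k, hk⟩ := hred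
  have hle := span_pow_mul_pow_le_of_reduction hk hda
  have hmem : ∀ (m : ℕ) (y : R), y ∈ a ^ m → d ^ k * y ∈ b ^ m := fun m y hy =>
    hle m (Ideal.mul_mem_mul (Ideal.mem_span_singleton_self _) hy)
  have hmem_mul : ∀ (m : ℕ) (J : Ideal R) (z : R), z ∈ a ^ m * J → d ^ k * z ∈ b ^ m * J := by
    intro m J z hz
    refine Ideal.mul_mono_left (hle m) ?_
    rw [mul_assoc]
    exact Ideal.mul_mem_mul (Ideal.mem_span_singleton_self _) hz
  have hpow (m : ℕ) : b ^ m ≤ a ^ m := Ideal.pow_right_mono hba m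
  have hdk := Rcirc.pow_mem hd k
  constructor
  · ext x
    constructor
    · rintro ⟨c, hc, E, h⟩
      refine ⟨d ^ k * c, Rcirc.mul_mem hdk hc, E, fun e he y hy => ?_⟩
      simpa only [mul_assoc] using hmem_mul _ _ _ (h e he y (hpow _ hy))
    · rintro ⟨c, hc, E, h⟩
      refine ⟨c * d ^ k, Rcirc.mul_mem hc hdk, E, fun e he y hy => ?_⟩
      have := Ideal.mul_mono_left (hpow _) (h e he _ (hmem _ y hy))
      rwa [mul_right_comm c, mul_assoc (c * _)]
  · ext x
    constructor
    · rintro ⟨c, hc, N, h⟩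
      exact ⟨c, hc, N, fun n hn y hy => h n hn y (hpow _ hy)⟩
    · rintro ⟨c, hc, N, h⟩
      refine ⟨c * d ^ k, Rcirc.mul_mem hc hdk, N, fun n hn y hy => ?_⟩
      have := h n hn _ (hmem _ y hy)
      rwa [mul_right_comm c, mul_assoc (c * _)]
end

section
/- Let R = ⊕_{n≥0} Rₙ be a reduced, finitely generated ℕ-graded algebra over a field 𝔽 = R₀, of positive Krull dimension, generated over R₀ by homogeneous elements y₁,…,yₛ of degrees β₁,…,βₛ; set β = max(βᵢ) and β' = min(βᵢ). Let R₊ = ⊕_{n>0} Rₙ, and let 𝔞 be a homogeneous R₊-primary ideal and k ≥ l integers with R₊^k ⊆ 𝔞 ⊆ R₊^l. Let I = (f₁,…,f_d) be a homogeneous ideal and set N = βk − β'l + max(deg fᵢ). Then for any element x ∈ R all of whose nonzero homogeneous components have degree ≥ N: (a) x ∈ Ī^{𝔞} if and only if x ∈ Ī (the ordinary integral closure of I); and (b) if 𝔽 has prime characteristic p > 0, then x ∈ I^{F𝔞} if and only if x ∈ ^{𝔞}I^F. -/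
open Ideal Filter
open scoped Pointwise

section ReducedNoetherian

variable {R : Type*} [CommRing R]

theorem eq_zero_of_mem_minimalPrimes [IsReduced R] {w : R}
    (h : ∀ P ∈ minimalPrimes R, w ∈ P) : w = 0 := by
  have hw : w ∈ sInf (⊥ : Ideal R).minimalPrimes := Ideal.mem_sInf.mpr fun {P} hP => h P hP
  rw [Ideal.sInf_minimalPrimes] at hw
  exact IsReduced.eq_zero w (mem_nilradical.mp hw)

theorem exists_mem_Rcirc_of_not_le [IsNoetherianRing R] {J : Ideal R}
    (h : ∀ P ∈ minimalPrimes R, ¬ J ≤ P) : ∃ c ∈ J, c ∈ Rcirc R := by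
  by_contra! hc
  have hfin := minimalPrimes.finite_of_isNoetherianRing R
  have hsub : (J : Set R) ⊆ ⋃ P ∈ (↑hfin.toFinset : Set (Ideal R)), (P : Set R) := by
    intro c hcJ
    have := hc c hcJ
    simp only [Rcirc, Set.mem_ofPred_eq, not_forall, not_not] at this
    obtain ⟨P, hP, hcP⟩ := this
    simp only [Set.mem_iUnion]
    exact ⟨P, by simpa using hP, hcP⟩
  obtain ⟨P, hP, hJP⟩ := (Ideal.subset_union_prime (f := id) ⊤ ⊤
    (fun P hP _ _ => (by simpa using hP : P ∈ minimalPrimes R).isPrime)).mp hsub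
  exact h P (by simpa using hP) hJP

theorem exists_notMem_mul_eq_zero [IsReduced R] {P : Ideal R} (hP : P ∈ minimalPrimes R)
    {x : R} (hx : x ∈ P) : ∃ s ∉ P, s * x = 0 := by
  have hprime := hP.isPrime
  obtain ⟨s, hs, n, hn⟩ : ∃ s ∉ P, ∃ n : ℕ, s * x ^ n = 0 := by
    by_contra! hc
    have hdisj : Disjoint ((⊥ : Ideal R) : Set R)
        (P.primeCompl ⊔ Submonoid.powers x : Submonoid R) := by
      rw [Set.disjoint_left]
      intro z hz hz'
      obtain ⟨s, hs, _, ⟨n, rfl⟩, rfl⟩ := Submonoid.mem_sup.mp hz'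
      exact hc s hs n hz
    obtain ⟨Q, hQ, -, hdQ⟩ := Ideal.exists_le_prime_disjoint _ _ hdisj
    have hQP : Q ≤ P := by
      intro z hz
      by_contra hzP
      exact Set.disjoint_left.mp hdQ hz (Submonoid.mem_sup_left hzP)
    exact Set.disjoint_left.mp hdQ (hP.2 ⟨hQ, bot_le⟩ hQP hx)
      (Submonoid.mem_sup_right (Submonoid.mem_powers x))
  refine ⟨s, hs, IsReduced.eq_zero _ ⟨n + 1, ?_⟩⟩
  rw [mul_pow, pow_succ s, pow_succ x]
  linear_combination (s ^ n * x) * hn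

end ReducedNoetherian

section IntegralClosure

variable {R : Type*} [CommRing R]

theorem exists_pow_mem_of_mem_intCl {I : Ideal R} {x : R} (hx : x ∈ intCl I) :
    ∃ n : ℕ, ∀ j : ℕ, x ^ (n + j) ∈ I ^ j := by
  obtain ⟨n, hn, r, hr, heq⟩ := hx
  obtain ⟨n, rfl⟩ := Nat.exists_eq_add_of_lt hn
  rw [zero_add] at hr heq
  set L := I ⊔ Ideal.span {x} with hL
  have hIL : I ≤ L := le_sup_left
  have hxL : x ∈ L := Ideal.mem_sup_right (Ideal.mem_span_singleton_self x)
  have hxn : x ^ (n + 1) ∈ I * L ^ n := by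
    rw [eq_neg_of_add_eq_zero_left heq]
    refine neg_mem (sum_mem fun i hi => ?_)
    have hi' : i ≤ n := by simpa [Nat.lt_succ_iff] using hi
    have h1 : r (i + 1) * x ^ (n + 1 - (i + 1)) ∈ I ^ (i + 1) * L ^ (n - i) := by
      rw [Nat.add_sub_add_right]
      exact Ideal.mul_mem_mul (hr _ (by omega) (by omega)) (Ideal.pow_mem_pow hxL _)
    have h2 : I ^ (i + 1) * L ^ (n - i) ≤ I * L ^ n := by
      calc I ^ (i + 1) * L ^ (n - i) = I * (I ^ i * L ^ (n - i)) := by ring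
        _ ≤ I * (L ^ i * L ^ (n - i)) := by gcongr
        _ = I * L ^ n := by rw [← pow_add, Nat.add_sub_cancel' hi']
    exact h2 h1
  have hstep : ∀ j, x ^ (n + j) ∈ I ^ j * L ^ n := by
    have key : L ^ (n + 1) ≤ I * L ^ n := by
      have hgen : ∀ m, L ^ m ≤ I * L ^ (m - 1) ⊔ Ideal.span {x ^ m} := by
        intro m
        cases m with
        | zero => simp
        | succ m =>
          induction m with
          | zero => simp [hL]
          | succ m ih =>
            simp only [Nat.add_sub_cancel] at ih ⊢
            calc L ^ (m + 2) = I * L ^ (m + 1) ⊔ Ideal.span {x} * L ^ (m + 1) := by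
                  rw [pow_succ', ← Ideal.sup_mul]
              _ ≤ I * L ^ (m + 1) ⊔ Ideal.span {x} * (I * L ^ m ⊔ Ideal.span {x ^ (m + 1)}) := by
                  gcongr
              _ ≤ I * L ^ (m + 1) ⊔ Ideal.span {x ^ (m + 2)} := by
                  rw [Ideal.mul_sup, ← sup_assoc]
                  refine sup_le (sup_le le_sup_left ?_) ?_
                  · refine le_sup_of_le_left ?_
                    calc Ideal.span {x} * (I * L ^ m) ≤ L * (I * L ^ m) :=
                          Ideal.mul_mono_left le_sup_right
                      _ = I * L ^ (m + 1) := by ring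
                  · rw [Ideal.span_singleton_mul_span_singleton, ← pow_succ']
                    exact le_sup_right
      refine (hgen (n + 1)).trans (sup_le le_rfl ?_)
      rwa [Ideal.span_singleton_le_iff_mem]
    intro j
    have : L ^ (n + j) ≤ I ^ j * L ^ n := by
      induction j with
      | zero => simp
      | succ j ih =>
        calc L ^ (n + (j + 1)) = L ^ (n + j) * L := by ring
          _ ≤ I ^ j * L ^ n * L := by gcongr
          _ = I ^ j * L ^ (n + 1) := by ring
          _ ≤ I ^ j * (I * L ^ n) := by gcongr
          _ = I ^ (j + 1) * L ^ n := by ring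
    exact this (Ideal.pow_mem_pow hxL _)
  exact ⟨n, fun j => Ideal.mul_le_left (hstep j)⟩

theorem mem_intCl_of_monic {I : Ideal R} {x : R} {p : Polynomial R} (hp : p.Monic)
    (hcoeff : ∀ i, p.coeff i ∈ I ^ (p.natDegree - i)) (hdeg : 0 < p.natDegree)
    (heval : p.eval x = 0) : x ∈ intCl I := by
  refine ⟨p.natDegree, hdeg, fun i => p.coeff (p.natDegree - i), fun i _ hi => ?_, ?_⟩
  · simpa [Nat.sub_sub_self hi] using hcoeff (p.natDegree - i)
  · rw [Polynomial.eval_eq_sum_range, Finset.sum_range_succ, hp.coeff_natDegree, one_mul,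
      ← Finset.sum_range_reflect] at heval
    rw [← heval, add_comm]
    congr 1
    refine Finset.sum_congr rfl fun i _ => ?_
    rw [Nat.sub_sub, add_comm 1 i]

/-- The determinant trick, up to a power of `x`. -/
theorem mem_intCl_of_mul_mem [IsNoetherianRing R] {I K : Ideal R} {x : R}
    (hxK : ∀ z ∈ K, x * z ∈ I * K) (n : ℕ)
    (hK : ∀ w, (∀ z ∈ K, w * z = 0) → w * x ^ n = 0) : x ∈ intCl I := by
  rcases subsingleton_or_nontrivial R with _ | _
  · exact ⟨1, one_pos, 0, by simp, Subsingleton.elim _ _⟩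
  have hrange : LinearMap.range (Module.toModuleEnd R K x) ≤ I • (⊤ : Submodule R K) := by
    rintro _ ⟨z, rfl⟩
    have hz : x * z ∈ (I • (⊤ : Submodule R K)).map K.subtype := by
      rw [Submodule.map_smul'', Submodule.map_top, Submodule.range_subtype]
      exact hxK z z.2
    obtain ⟨v, hv, hvz⟩ := hz
    rwa [show Module.toModuleEnd R K x z = v from Subtype.ext hvz.symm]
  obtain ⟨p, hp, -, hc, hev⟩ :=
    LinearMap.exists_monic_and_natDegree_eq_and_coeff_mem_pow_and_aeval_eq_zero R
      (Module.toModuleEnd R K x) I hrange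
  have hpK : ∀ z ∈ K, p.eval x * z = 0 := by
    intro z hz
    have h1 := congrArg (fun g : Module.End R K => (g ⟨z, hz⟩ : R)) hev
    have h2 : Polynomial.aeval (Module.toModuleEnd R K x) p
        = Module.toModuleEnd R K (p.eval x) := by
      have := Polynomial.aeval_algHom_apply (Algebra.ofId R (Module.End R K)) x p
      rwa [Polynomial.coe_aeval_eq_eval] at this
    rw [h2] at h1
    simpa using h1
  have hdeg : (p * Polynomial.X ^ (n + 1)).natDegree = p.natDegree + (n + 1) := by
    rw [hp.natDegree_mul (Polynomial.monic_X_pow _), Polynomial.natDegree_X_pow]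
  refine mem_intCl_of_monic (hp.mul (Polynomial.monic_X_pow (n + 1))) (fun i => ?_)
    (by omega) ?_
  · rw [hdeg, Polynomial.coeff_mul_X_pow']
    split_ifs with hi
    · rw [show p.natDegree + (n + 1) - i = p.natDegree - (i - (n + 1)) by omega]
      exact hc _
    · exact zero_mem _
  · rw [Polynomial.eval_mul, Polynomial.eval_pow, Polynomial.eval_X, pow_succ, ← mul_assoc,
      hK _ hpK, zero_mul]

theorem mem_intCl_of_mul_pow_mem [IsReduced R] [IsNoetherianRing R] {I a : Ideal R} {x c : R}
    (ha : ∀ P ∈ minimalPrimes R, ¬ a ≤ P) (hc : c ∈ Rcirc R) (N : ℕ)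
    (h : ∀ n, N ≤ n → ∀ z ∈ a ^ n, c * x ^ n * z ∈ a ^ n * I ^ n) : x ∈ intCl I := by
  set L := I ⊔ Ideal.span {x} with hL
  have hle : ∀ m j, Ideal.span {c * x ^ j} * (a ^ (j + m) * L ^ m) ≤ (a * I) ^ (j + m - N) := by
    intro m
    induction m with
    | zero =>
      intro j
      rcases lt_or_ge j N with hj | hj
      · simp [Nat.sub_eq_zero_of_le hj.le]
      · rw [pow_zero, mul_one, add_zero, Ideal.span_singleton_mul_le_iff]
        intro z hz
        refine Ideal.pow_le_pow_right (Nat.sub_le j N) ?_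
        rw [mul_pow]
        exact h j hj z hz
    | succ m ih =>
      intro j
      calc Ideal.span {c * x ^ j} * (a ^ (j + (m + 1)) * L ^ (m + 1))
          = a * I * (Ideal.span {c * x ^ j} * (a ^ (j + m) * L ^ m)) ⊔
            Ideal.span {c * x ^ (j + 1)} * (a ^ (j + 1 + m) * L ^ m) := by
            have hspan : Ideal.span {c * x ^ (j + 1)}
                = Ideal.span {c * x ^ j} * Ideal.span {x} := by
              rw [Ideal.span_singleton_mul_span_singleton, pow_succ, mul_assoc]
            have hpow : L ^ (m + 1) = I * L ^ m ⊔ Ideal.span {x} * L ^ m := by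
              rw [pow_succ', ← Ideal.sup_mul]
            rw [hspan, hpow, Ideal.mul_sup, Ideal.mul_sup]
            congr 1 <;> ring
        _ ≤ (a * I) ^ (j + (m + 1) - N) := by
            refine sup_le ?_ ?_
            · calc a * I * (Ideal.span {c * x ^ j} * (a ^ (j + m) * L ^ m))
                  ≤ a * I * (a * I) ^ (j + m - N) := by gcongr; exact ih j
                _ = (a * I) ^ (j + m - N + 1) := (pow_succ' _ _).symm
                _ ≤ _ := Ideal.pow_le_pow_right (by omega)
            · rw [show j + (m + 1) - N = j + 1 + m - N by omega]
              exact ih (j + 1)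
  let F : (a * I).Filtration R :=
    { N := fun n => Ideal.span {c} * (a ^ (n + N) * L ^ (n + N))
      mono := fun n => by
        exact Ideal.mul_mono_right (Ideal.mul_mono (Ideal.pow_le_pow_right (by omega))
          (Ideal.pow_le_pow_right (by omega)))
      smul_le := fun n => by
        rw [smul_eq_mul]
        calc a * I * (Ideal.span {c} * (a ^ (n + N) * L ^ (n + N)))
            ≤ a * L * (Ideal.span {c} * (a ^ (n + N) * L ^ (n + N))) := by
              gcongr; exact le_sup_left
          _ = Ideal.span {c} * (a ^ (n + 1 + N) * L ^ (n + 1 + N)) := by ring }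
  have hF : F.Stable := by
    refine ((a * I).stableFiltration_stable (⊤ : Submodule R R)).of_le fun n => ?_
    have := hle (n + N) 0
    simpa [F] using this
  obtain ⟨n, hn⟩ := hF
  have hn : a * I * (Ideal.span {c} * (a ^ (n + N) * L ^ (n + N)))
    = Ideal.span {c} * (a ^ (n + 1 + N) * L ^ (n + 1 + N)) := hn n le_rfl
  refine mem_intCl_of_mul_mem (K := Ideal.span {c} * (a ^ (n + N + 1) * L ^ (n + N)))
    (fun z hz => ?_) (n + N) fun w hw => ?_
  · have : x * z ∈ L * (Ideal.span {c} * (a ^ (n + N + 1) * L ^ (n + N))) :=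
      Ideal.mul_mem_mul (Ideal.mem_sup_right (Ideal.mem_span_singleton_self x)) hz
    convert this using 1
    calc I * (Ideal.span {c} * (a ^ (n + N + 1) * L ^ (n + N)))
        = a * I * (Ideal.span {c} * (a ^ (n + N) * L ^ (n + N))) := by ring
      _ = _ := by rw [hn]; ring
  · refine eq_zero_of_mem_minimalPrimes fun P hP => ?_
    have hprime := hP.isPrime
    by_contra hwP
    refine ha P hP (Ideal.IsPrime.le_of_pow_le (n := n + N + 1) fun b hb => ?_)
    have := hw _ (Ideal.mul_mem_mul (Ideal.mem_span_singleton_self c) (Ideal.mul_mem_mul hb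
      (Ideal.pow_mem_pow (Ideal.mem_sup_right (Ideal.mem_span_singleton_self x)) (n + N))))
    have hmem : w * x ^ (n + N) * (c * b) ∈ P := by
      rw [show w * x ^ (n + N) * (c * b) = w * (c * (b * x ^ (n + N))) by ring, this]
      exact zero_mem P
    exact ((hprime.mem_or_mem ((hprime.mem_or_mem hmem).resolve_left hwP)).resolve_left
      (hc P hP))

theorem HYIntCl_of_mem_intCl [IsReduced R] [IsNoetherianRing R] {I a : Ideal R} {x : R} {t : ℝ}
    (hx : x ∈ intCl I) : x ∈ HYIntCl I a t := by
  obtain ⟨n, hn⟩ := exists_pow_mem_of_mem_intCl hx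
  obtain ⟨c, hcJ, hc⟩ : ∃ c ∈ I ^ n ⊔ LinearMap.ker (LinearMap.mulRight R x), c ∈ Rcirc R := by
    refine exists_mem_Rcirc_of_not_le fun P hP hle => ?_
    have hprime := hP.isPrime
    have hIP : I ≤ P := Ideal.IsPrime.le_of_pow_le (le_sup_left.trans hle)
    have hxP : x ∈ P := hprime.mem_of_pow_mem (n + 1) (hIP (by simpa using hn 1))
    obtain ⟨s, hs, hsx⟩ := exists_notMem_mul_eq_zero hP hxP
    exact hs (hle (Ideal.mem_sup_right (by simpa using hsx)))
  obtain ⟨u, hu, v, hv, rfl⟩ := Submodule.mem_sup.mp hcJ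
  refine ⟨u + v, hc, n + 1, fun m hm y _ => Ideal.mul_mem_right _ _ ?_⟩
  obtain ⟨j, rfl⟩ := Nat.exists_eq_add_of_le hm
  have hvx : v * x = 0 := by simpa using hv
  have : (u + v) * x ^ (n + 1 + j) = u * x ^ (n + (1 + j)) := by
    linear_combination x ^ (n + j) * hvx
  rw [this, add_assoc n, pow_add I]
  exact Ideal.mul_mem_mul hu (hn _)

end IntegralClosure

section Graded

variable {𝔽 R : Type*} [Field 𝔽] [CommRing R] [Algebra 𝔽 R]
  (𝒜 : ℕ → Submodule 𝔽 R)

/-- The ideal generated by the homogeneous elements of degree at least `T`. -/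
def idealGE (T : ℕ) : Ideal R :=
  Ideal.span (⋃ m ≥ T, (𝒜 m : Set R))

variable {𝒜}

theorem mem_idealGE_of_mem {T m : ℕ} (h : T ≤ m) {z : R} (hz : z ∈ 𝒜 m) : z ∈ idealGE 𝒜 T :=
  Ideal.subset_span (Set.mem_biUnion h hz)

variable [GradedAlgebra 𝒜]

theorem idealGE_mul_le (S T : ℕ) : idealGE 𝒜 S * idealGE 𝒜 T ≤ idealGE 𝒜 (S + T) := by
  rw [idealGE, idealGE, Ideal.span_mul_span', Ideal.span_le]
  rintro _ ⟨u, hu, v, hv, rfl⟩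
  simp only [Set.mem_iUnion] at hu hv
  obtain ⟨i, hi, hui⟩ := hu
  obtain ⟨j, hj, hvj⟩ := hv
  exact mem_idealGE_of_mem (add_le_add hi hj) (SetLike.mul_mem_graded hui hvj)

theorem idealGE_pow_le (T n : ℕ) : idealGE 𝒜 T ^ n ≤ idealGE 𝒜 (T * n) := by
  induction n with
  | zero =>
    rw [pow_zero, mul_zero, Ideal.one_eq_top, top_le_iff, Ideal.eq_top_iff_one]
    exact mem_idealGE_of_mem le_rfl SetLike.GradedOne.one_mem
  | succ n ih =>
    rw [pow_succ, mul_add_one]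
    exact (Ideal.mul_mono_left ih).trans (idealGE_mul_le _ _)

theorem decompose_eq_zero_of_mem_idealGE {T m : ℕ} (hm : m < T) {z : R}
    (hz : z ∈ idealGE 𝒜 T) : (DirectSum.decompose 𝒜 z m : R) = 0 := by
  induction hz using Submodule.span_induction with
  | mem z hz =>
    simp only [Set.mem_iUnion] at hz
    obtain ⟨i, hi, hzi⟩ := hz
    exact DirectSum.decompose_of_mem_ne 𝒜 hzi (by omega)
  | zero => simp
  | add u v _ _ hu hv => simp [DirectSum.decompose_add, hu, hv]
  | smul r z hz' _ =>
    clear * - hm hz'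
    induction hz' using Submodule.span_induction generalizing r with
    | mem z hz =>
      simp only [Set.mem_iUnion] at hz
      obtain ⟨i, hi, hzi⟩ := hz
      exact DirectSum.coe_decompose_mul_of_right_mem_of_not_le 𝒜 hzi (by omega)
    | zero => simp
    | add u v _ _ hu hv =>
      rw [smul_add, DirectSum.decompose_add, DirectSum.add_apply, Submodule.coe_add, hu, hv,
        add_zero]
    | smul r' z _ ih => rw [smul_smul]; exact ih _

theorem mem_of_forall_decompose_mem {z : R} {J : Ideal R}
    (h : ∀ m, (DirectSum.decompose 𝒜 z m : R) ∈ J) : z ∈ J := by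
  classical
  rw [← DirectSum.sum_support_decompose 𝒜 z]
  exact sum_mem fun m _ => h m

theorem mem_idealGE_iff {T : ℕ} {z : R} :
    z ∈ idealGE 𝒜 T ↔ ∀ m < T, (DirectSum.decompose 𝒜 z m : R) = 0 := by
  refine ⟨fun hz m hm => decompose_eq_zero_of_mem_idealGE hm hz, fun h => ?_⟩
  refine mem_of_forall_decompose_mem (𝒜 := 𝒜) fun m => ?_
  rcases lt_or_ge m T with hm | hm
  · rw [h m hm]
    exact zero_mem _
  · exact mem_idealGE_of_mem hm (SetLike.coe_mem _)

theorem irrelevant_eq_idealGE_one :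
    (HomogeneousIdeal.irrelevant 𝒜).toIdeal = idealGE 𝒜 1 := by
  rw [HomogeneousIdeal.irrelevant_eq_span]
  rfl

/-- An ideal generated by homogeneous elements of degree at most `D`. -/
def GeneratedInDegreesLE (𝒜 : ℕ → Submodule 𝔽 R) (J : Ideal R) (D : ℕ) : Prop :=
  ∃ S : Set R, J = Ideal.span S ∧ ∀ z ∈ S, ∃ j ≤ D, z ∈ 𝒜 j

theorem GeneratedInDegreesLE.pow {J : Ideal R} {D : ℕ} (h : GeneratedInDegreesLE 𝒜 J D) (n : ℕ) :
    GeneratedInDegreesLE 𝒜 (J ^ n) (D * n) := by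
  obtain ⟨S, rfl, hS⟩ := h
  induction n with
  | zero =>
    refine ⟨{1}, by simp, ?_⟩
    rintro _ rfl
    exact ⟨0, Nat.zero_le _, SetLike.GradedOne.one_mem⟩
  | succ n ih =>
    obtain ⟨T, hT, hTD⟩ := ih
    refine ⟨T * S, by rw [pow_succ, hT, Ideal.span_mul_span'], ?_⟩
    rintro _ ⟨u, hu, v, hv, rfl⟩
    obtain ⟨i, hi, hui⟩ := hTD u hu
    obtain ⟨j, hj, hvj⟩ := hS v hv
    exact ⟨i + j, by rw [mul_add_one]; exact add_le_add hi hj, SetLike.mul_mem_graded hui hvj⟩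

theorem GeneratedInDegreesLE.mem_idealGE_mul {J : Ideal R} {D T : ℕ}
    (h : GeneratedInDegreesLE 𝒜 J D) {w : R} (hwJ : w ∈ J) (hw : w ∈ idealGE 𝒜 (T + D)) :
    w ∈ idealGE 𝒜 T * J := by
  obtain ⟨S, rfl, hS⟩ := h
  have key : ∀ m, T + D ≤ m →
      (DirectSum.decompose 𝒜 w m : R) ∈ idealGE 𝒜 T * Ideal.span S := by
    intro m hm
    clear hw
    rw [Ideal.span, ← Set.image_id S, Finsupp.mem_span_image_iff_linearCombination] at hwJ
    obtain ⟨r, hr, rfl⟩ := hwJ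
    rw [Finsupp.linearCombination_apply, Finsupp.sum, DirectSum.decompose_sum,
      DirectSum.sum_apply, AddSubmonoidClass.coe_finsetSum]
    refine sum_mem fun z hz => ?_
    have hzS : z ∈ S := hr hz
    obtain ⟨j, hj, hzj⟩ := hS z hzS
    rw [smul_eq_mul, id, DirectSum.coe_decompose_mul_of_right_mem_of_le 𝒜 hzj (by omega)]
    exact Ideal.mul_mem_mul (mem_idealGE_of_mem (by omega) (SetLike.coe_mem _))
      (Ideal.subset_span hzS)
  refine mem_of_forall_decompose_mem (𝒜 := 𝒜) fun m => ?_
  rcases lt_or_ge m (T + D) with hm | hm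
  · rw [decompose_eq_zero_of_mem_idealGE hm hw]
    exact zero_mem _
  · exact key m hm

section Generators

variable {ι : Type*} [Fintype ι] {y : ι → R} {β : ι → ℕ}

theorem prod_pow_mem_graded (hy : ∀ i, y i ∈ 𝒜 (β i)) (e : ι → ℕ) :
    ∏ i, y i ^ e i ∈ 𝒜 (∑ i, e i * β i) :=
  SetLike.prod_mem_graded (F := Finset.univ) 𝒜 (fun i => e i * β i) (fun i => y i ^ e i)
    fun i _ => SetLike.pow_mem_graded (e i) (hy i)

/-- Each homogeneous component is a linear combination of monomials of that degree. -/
theorem decompose_mem_span_monomials (hy : ∀ i, y i ∈ 𝒜 (β i))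
    (hgen : Algebra.adjoin 𝔽 (Set.range y) = ⊤) (w : R) (m : ℕ) :
    (DirectSum.decompose 𝒜 w m : R) ∈
      Submodule.span 𝔽 {z | ∃ e : ι → ℕ, ∑ i, e i * β i = m ∧ ∏ i, y i ^ e i = z} := by
  have hw : w ∈ Algebra.adjoin 𝔽 (Set.range y) := hgen ▸ Algebra.mem_top
  rw [Algebra.adjoin_range_eq_range_aeval] at hw
  obtain ⟨q, rfl⟩ := hw
  induction q using MvPolynomial.induction_on' with
  | monomial e r =>
    rw [AlgHom.toRingHom_eq_coe, RingHom.coe_coe, MvPolynomial.aeval_monomial, ← Algebra.smul_def,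
      DirectSum.decompose_smul, DirectSum.smul_apply, Submodule.coe_smul]
    refine Submodule.smul_mem _ _ ?_
    rw [Finsupp.prod_fintype _ _ (by simp)]
    by_cases hm : ∑ i, e i * β i = m
    · subst hm
      rw [DirectSum.decompose_of_mem_same 𝒜 (prod_pow_mem_graded hy _)]
      exact Submodule.subset_span ⟨_, rfl, rfl⟩
    · rw [DirectSum.decompose_of_mem_ne 𝒜 (prod_pow_mem_graded hy _) hm]
      exact zero_mem _
  | add p q hp hq =>
    rw [map_add, DirectSum.decompose_add, DirectSum.add_apply, Submodule.coe_add]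
    exact add_mem hp hq

theorem decompose_mem_of_monomials_mem (hy : ∀ i, y i ∈ 𝒜 (β i))
    (hgen : Algebra.adjoin 𝔽 (Set.range y) = ⊤) {J : Ideal R} {m : ℕ}
    (h : ∀ e : ι → ℕ, ∑ i, e i * β i = m → ∏ i, y i ^ e i ∈ J) (w : R) :
    (DirectSum.decompose 𝒜 w m : R) ∈ J := by
  have hle : Submodule.span 𝔽 {z | ∃ e : ι → ℕ, ∑ i, e i * β i = m ∧ ∏ i, y i ^ e i = z}
      ≤ J.restrictScalars 𝔽 := by
    rw [Submodule.span_le]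
    rintro _ ⟨e, he, rfl⟩
    exact h e he
  exact hle (decompose_mem_span_monomials hy hgen w m)

theorem idealGE_mul_le_irrelevant_pow (hy : ∀ i, y i ∈ 𝒜 (β i))
    (hgen : Algebra.adjoin 𝔽 (Set.range y) = ⊤) {B : ℕ} (hB : 0 < B) (hβ : ∀ i, β i ≤ B)
    (n : ℕ) : idealGE 𝒜 (B * n) ≤ (HomogeneousIdeal.irrelevant 𝒜).toIdeal ^ n := by
  intro w hw
  refine mem_of_forall_decompose_mem (𝒜 := 𝒜) fun m => ?_
  rcases lt_or_ge m (B * n) with hm | hm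
  · rw [decompose_eq_zero_of_mem_idealGE hm hw]
    exact zero_mem _
  refine decompose_mem_of_monomials_mem hy hgen (fun e he => ?_) w
  set M := (HomogeneousIdeal.irrelevant 𝒜).toIdeal
  have hprod : ∏ i, y i ^ e i ∈ M ^ ∑ i, (if β i = 0 then 0 else e i) := by
    rw [← Finset.prod_pow_eq_pow_sum]
    refine Ideal.prod_mem_prod fun i _ => ?_
    split_ifs with h0
    · simp
    · exact Ideal.pow_mem_pow
        (HomogeneousIdeal.mem_irrelevant_of_mem 𝒜 (Nat.pos_of_ne_zero h0) (hy i)) _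
  refine Ideal.pow_le_pow_right ?_ hprod
  have hsum : m ≤ B * ∑ i, (if β i = 0 then 0 else e i) := by
    rw [← he, Finset.mul_sum]
    refine Finset.sum_le_sum fun i _ => ?_
    split_ifs with h0
    · simp [h0]
    · rw [mul_comm B]
      exact Nat.mul_le_mul_left _ (hβ i)
  exact Nat.le_of_mul_le_mul_left (hm.trans hsum) hB

theorem irrelevant_le_idealGE (hy : ∀ i, y i ∈ 𝒜 (β i))
    (hgen : Algebra.adjoin 𝔽 (Set.range y) = ⊤) {b : ℕ} (hβ : ∀ i, b ≤ β i) :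
    (HomogeneousIdeal.irrelevant 𝒜).toIdeal ≤ idealGE 𝒜 b := by
  intro w hw
  refine mem_of_forall_decompose_mem (𝒜 := 𝒜) fun m => ?_
  rcases Nat.eq_zero_or_pos m with rfl | hm
  · rw [irrelevant_eq_idealGE_one] at hw
    rw [decompose_eq_zero_of_mem_idealGE one_pos hw]
    exact zero_mem _
  refine decompose_mem_of_monomials_mem hy hgen (fun e he => ?_) w
  obtain ⟨i, -, hi⟩ : ∃ i ∈ Finset.univ, e i * β i ≠ 0 := by
    by_contra! hc
    rw [Finset.sum_eq_zero hc] at he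
    omega
  refine mem_idealGE_of_mem ?_ (prod_pow_mem_graded hy e)
  calc b ≤ β i := hβ i
    _ ≤ e i * β i := Nat.le_mul_of_pos_left _ (Nat.pos_of_ne_zero (left_ne_zero_of_mul hi))
    _ ≤ ∑ i, e i * β i := Finset.single_le_sum (f := fun i => e i * β i)
        (fun _ _ => Nat.zero_le _) (Finset.mem_univ i)

theorem irrelevant_eq_bot_of_forall_degree_eq_zero (hy : ∀ i, y i ∈ 𝒜 (β i))
    (hgen : Algebra.adjoin 𝔽 (Set.range y) = ⊤) (hβ : ∀ i, β i = 0) :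
    (HomogeneousIdeal.irrelevant 𝒜).toIdeal = ⊥ := by
  rw [eq_bot_iff]
  intro w hw
  refine mem_of_forall_decompose_mem (𝒜 := 𝒜) fun m => ?_
  rcases Nat.eq_zero_or_pos m with rfl | hm
  · rw [irrelevant_eq_idealGE_one] at hw
    rw [decompose_eq_zero_of_mem_idealGE one_pos hw]
    exact zero_mem _
  · refine decompose_mem_of_monomials_mem hy hgen (fun e he => ?_) w
    simp only [hβ, mul_zero, Finset.sum_const_zero] at he
    omega

end Generators

theorem exists_sub_mem_irrelevant (h0 : 𝒜 0 = 1) (w : R) :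
    ∃ r : 𝔽, w - algebraMap 𝔽 R r ∈ (HomogeneousIdeal.irrelevant 𝒜).toIdeal := by
  have hw0 : (DirectSum.decompose 𝒜 w 0 : R) ∈ 𝒜 0 := SetLike.coe_mem _
  obtain ⟨r, hr⟩ := Submodule.mem_one.mp (h0.le hw0)
  refine ⟨r, ?_⟩
  rw [irrelevant_eq_idealGE_one, mem_idealGE_iff]
  intro m hm
  obtain rfl : m = 0 := by omega
  rw [hr, DirectSum.decompose_sub, DirectSum.sub_apply, Submodule.coe_sub,
    DirectSum.decompose_of_mem_same 𝒜 (SetLike.coe_mem _), sub_self]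

theorem irrelevant_ne_bot (h0 : 𝒜 0 = 1) (hdim : 0 < ringKrullDim R) :
    (HomogeneousIdeal.irrelevant 𝒜).toIdeal ≠ ⊥ := by
  intro hbot
  have : Nontrivial R := by
    by_contra hR
    rw [not_nontrivial_iff_subsingleton] at hR
    rw [ringKrullDim_eq_bot_of_subsingleton] at hdim
    exact not_lt_bot hdim
  refine hdim.ne' (ringKrullDim_eq_zero_of_isField ⟨⟨0, 1, zero_ne_one⟩, mul_comm, ?_⟩)
  intro w hw
  obtain ⟨r, hr⟩ := exists_sub_mem_irrelevant h0 w
  rw [hbot, Ideal.mem_bot, sub_eq_zero] at hr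
  have hr0 : r ≠ 0 := by
    rintro rfl
    exact hw (by simpa using hr)
  exact ⟨algebraMap 𝔽 R r⁻¹, by rw [hr, ← map_mul, mul_inv_cancel₀ hr0, map_one]⟩

theorem not_irrelevant_le_of_mem_minimalPrimes [IsReduced R] (h0 : 𝒜 0 = 1)
    (hdim : 0 < ringKrullDim R) {P : Ideal R} (hP : P ∈ minimalPrimes R) :
    ¬ (HomogeneousIdeal.irrelevant 𝒜).toIdeal ≤ P := by
  intro hle
  refine irrelevant_ne_bot h0 hdim (eq_bot_iff.mpr fun z hz => ?_)
  obtain ⟨s, hs, hsz⟩ := exists_notMem_mul_eq_zero hP (hle hz)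
  obtain ⟨r, hr⟩ := exists_sub_mem_irrelevant h0 s
  have hr0 : r ≠ 0 := by
    rintro rfl
    exact hs (hle (by simpa using hr))
  have hzeq : z = algebraMap 𝔽 R r⁻¹ * (-(s - algebraMap 𝔽 R r)) * z := by
    have hinv : algebraMap 𝔽 R r⁻¹ * algebraMap 𝔽 R r = 1 := by
      rw [← map_mul, inv_mul_cancel₀ hr0, map_one]
    linear_combination (-z) * hinv + algebraMap 𝔽 R r⁻¹ * hsz
  have hall : ∀ T, z ∈ idealGE 𝒜 T := by
    intro T
    induction T with
    | zero => exact mem_idealGE_iff.mpr fun m hm => absurd hm (Nat.not_lt_zero m)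
    | succ T ih =>
      rw [hzeq, add_comm]
      rw [irrelevant_eq_idealGE_one] at hr
      exact idealGE_mul_le _ _ (Ideal.mul_mem_mul (Ideal.mul_mem_left _ _ (neg_mem hr)) ih)
  refine mem_of_forall_decompose_mem (𝒜 := 𝒜) fun m => ?_
  rw [decompose_eq_zero_of_mem_idealGE (Nat.lt_succ_self m) (hall (m + 1))]
  exact zero_mem _

end Graded

theorem fbp_span_range {R : Type*} [CommRing R] {p : ℕ} [ExpChar R p] {ι : Type*} (f : ι → R)
    (e : ℕ) : fbp (Ideal.span (Set.range f)) (p ^ e)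
      = Ideal.span (Set.range fun i => f i ^ p ^ e) := by
  have h : ∀ J : Ideal R, fbp J (p ^ e) = J.map (iterateFrobenius R p e) := by
    intro J
    rw [fbp, Ideal.map]
    congr 1
  rw [h, Ideal.map_span, ← Set.range_comp]
  rfl

theorem graded_adjusted_closures {𝔽 R : Type*} [Field 𝔽] [CommRing R] [Algebra 𝔽 R]
    [IsReduced R] (hdim : 0 < ringKrullDim R)
    (𝒜 : ℕ → Submodule 𝔽 R) [GradedAlgebra 𝒜] (h0 : 𝒜 0 = (1 : Submodule 𝔽 R))
    (s : ℕ) (hs : 0 < s) (y : Fin s → R) (βs : Fin s → ℕ)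
    (hy : ∀ i, y i ∈ 𝒜 (βs i)) (hgen : Algebra.adjoin 𝔽 (Set.range y) = ⊤)
    (𝔞 : Ideal R) (h𝔞hom : Ideal.IsHomogeneous 𝒜 𝔞) (h𝔞prim : 𝔞.IsPrimary)
    (h𝔞rad : 𝔞.radical = (HomogeneousIdeal.irrelevant 𝒜).toIdeal)
    (k l : ℕ) (hkl : l ≤ k)
    (hk : (HomogeneousIdeal.irrelevant 𝒜).toIdeal ^ k ≤ 𝔞)
    (hl : 𝔞 ≤ (HomogeneousIdeal.irrelevant 𝒜).toIdeal ^ l)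
    (d : ℕ) (hd : 0 < d) (f : Fin d → R) (df : Fin d → ℕ) (hf : ∀ i, f i ∈ 𝒜 (df i))
    (I : Ideal R) (hI : I = Ideal.span (Set.range f))
    (N : ℕ)
    (hN : N = (Finset.univ.sup βs) * k
        - (Finset.univ.inf' (Finset.univ_nonempty_iff.mpr ⟨⟨0, hs⟩⟩) βs) * l
        + Finset.univ.sup df)
    (x : R) (hx : ∀ m : ℕ, m < N → (DirectSum.decompose 𝒜 x m : R) = 0) :
    (x ∈ HYIntCl I 𝔞 1 ↔ x ∈ intCl I) ∧
    (∀ p : ℕ, p.Prime → CharP R p → (x ∈ HYFrobCl p I 𝔞 1 ↔ x ∈ VFrobCl p I 𝔞 1)) := by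
  subst hI
  set M := (HomogeneousIdeal.irrelevant 𝒜).toIdeal with hM
  set I := Ideal.span (Set.range f) with hI
  set B := Finset.univ.sup βs
  set b := Finset.univ.inf' (Finset.univ_nonempty_iff.mpr ⟨⟨0, hs⟩⟩) βs
  set D := Finset.univ.sup df
  have hβB : ∀ i, βs i ≤ B := fun i => Finset.le_sup (Finset.mem_univ i)
  have hbβ : ∀ i, b ≤ βs i := fun i => Finset.inf'_le _ (Finset.mem_univ i)
  have hB : 0 < B := by
    rw [Nat.pos_iff_ne_zero]
    intro hB0
    exact irrelevant_ne_bot h0 hdim (irrelevant_eq_bot_of_forall_degree_eq_zero hy hgen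
      fun i => Nat.le_zero.mp (hB0 ▸ hβB i))
  have hN' : B * k + D ≤ N + b * l := by omega
  have hred : ∀ {J : Ideal R} {n : ℕ} {c z : R}, GeneratedInDegreesLE 𝒜 J (D * n) →
      z ∈ 𝔞 ^ n → c * x ^ n * z ∈ J → c * x ^ n * z ∈ 𝔞 ^ n * J := by
    intro J n c z hJ hz hmem
    have hxn : x ^ n ∈ idealGE 𝒜 (N * n) :=
      idealGE_pow_le N n (Ideal.pow_mem_pow (mem_idealGE_iff.mpr hx) n)
    have hzn : z ∈ idealGE 𝒜 (b * (l * n)) := by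
      refine idealGE_pow_le b (l * n) (Ideal.pow_right_mono (irrelevant_le_idealGE hy hgen hbβ) _ ?_)
      rw [pow_mul]
      exact Ideal.pow_right_mono hl n hz
    have hdeg : B * (k * n) + D * n ≤ N * n + b * (l * n) := by
      calc B * (k * n) + D * n = (B * k + D) * n := by ring
        _ ≤ (N + b * l) * n := Nat.mul_le_mul_right _ hN'
        _ = N * n + b * (l * n) := by ring
    have hge : c * x ^ n * z ∈ idealGE 𝒜 (B * (k * n) + D * n) := by
      have := idealGE_mul_le _ _ (Ideal.mul_mem_mul (Ideal.mul_mem_left _ c hxn) hzn)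
      rw [mem_idealGE_iff] at this ⊢
      exact fun m hm => this m (hm.trans_le hdeg)
    refine Ideal.mul_mono_left ?_ (hJ.mem_idealGE_mul hmem hge)
    calc idealGE 𝒜 (B * (k * n)) ≤ M ^ (k * n) :=
          idealGE_mul_le_irrelevant_pow hy hgen hB hβB _
      _ = (M ^ k) ^ n := pow_mul _ _ _
      _ ≤ 𝔞 ^ n := Ideal.pow_right_mono hk n
  have : IsNoetherianRing R := by
    have : Algebra.FiniteType 𝔽 R := 
      ⟨Subalgebra.fg_def.mpr ⟨_, Set.finite_range y, hgen⟩⟩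
    exact Algebra.FiniteType.isNoetherianRing 𝔽 R
  have hIgen : GeneratedInDegreesLE 𝒜 I D := by
    refine ⟨Set.range f, rfl, ?_⟩
    rintro _ ⟨i, rfl⟩
    exact ⟨df i, Finset.le_sup (Finset.mem_univ i), hf i⟩
  refine ⟨⟨fun ⟨c, hc, n₀, h⟩ => ?_, HYIntCl_of_mem_intCl⟩, fun p hp hchar => ⟨?_, ?_⟩⟩
  · refine mem_intCl_of_mul_pow_mem (a := 𝔞) (fun P hP hle => ?_) hc n₀ fun n hn z hz => ?_
    · refine not_irrelevant_le_of_mem_minimalPrimes h0 hdim hP ?_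
      rw [← hM, ← h𝔞rad]
      exact hP.isPrime.radical_le_iff.mpr hle
    · exact hred (hIgen.pow n) hz (h n hn z (by simpa using hz))
  · rintro ⟨E, h⟩
    refine ⟨E, fun e he z hz => ?_⟩
    have : Fact p.Prime := ⟨hp⟩
    have hceil : ⌈(1 : ℝ) * (p : ℝ) ^ e⌉₊ = p ^ e := by
      rw [one_mul, ← Nat.cast_pow, Nat.ceil_natCast]
    have hmem := h e he z hz
    rw [hceil] at hz ⊢
    have hgenq : GeneratedInDegreesLE 𝒜 (fbp I (p ^ e)) (D * p ^ e) := by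
      refine ⟨_, fbp_span_range f e, ?_⟩
      rintro _ ⟨i, rfl⟩
      have hle : df i ≤ D := Finset.le_sup (Finset.mem_univ i)
      exact ⟨p ^ e * df i, (Nat.mul_le_mul_left _ hle).trans_eq (mul_comm _ _),
        SetLike.pow_mem_graded (p ^ e) (hf i)⟩
    have hred_one := hred (n := p ^ e) (c := 1) (z := z) hgenq hz
    rw [one_mul] at hred_one
    exact hred_one hmem
  · rintro ⟨E, h⟩
    exact ⟨E, fun e he z hz => Ideal.mul_le_right (h e he z hz)⟩
end

section
/- Let S be a finitely generated submonoid of ℤ^d which generates ℤ^d as a group, let σ^∨ ⊆ ℝ^d be the convex cone generated by S, let a₁,…,a_r ∈ S, and let H ⊆ ℝ^d be the convex hull of {a₁,…,a_r}. Then: (a) for every n ∈ ℕ, every w ∈ ℕ^r with w₁ + ⋯ + w_r = n, and every u ∈ σ^∨, the vector Σᵢ wᵢaᵢ + u lies in n·H + σ^∨; and (b) for every real s > 0 and every v ∈ s·H, there exist w ∈ ℕ^r with w₁ + ⋯ + w_r ≥ ⌊s − d⌋ and u ∈ σ^∨ such that v = Σᵢ wᵢaᵢ + u. -/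
open Ideal Filter
open scoped Pointwise

/-- Coordinatewise embedding `ℤ^d → ℝ^d`. -/
def castR {d : ℕ} (v : Fin d → ℤ) : Fin d → ℝ := fun j => (v j : ℝ)

/-- A natural-number combination of the `a i` with total weight `n` lies in `n • H`. -/
theorem sum_natCast_smul_mem_smul_convexHull {E ι : Type*} [AddCommGroup E] [Module ℝ E]
    [Fintype ι] [Nonempty ι] (b : ι → E) (w : ι → ℕ) :
    (∑ i, (w i : ℝ) • b i) ∈ ((∑ i, w i : ℕ) : ℝ) • convexHull ℝ (Set.range b) := by
  rcases Nat.eq_zero_or_pos (∑ i, w i) with h | h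
  · have hw : ∀ i, w i = 0 := by simpa using h
    have hne : (convexHull ℝ (Set.range b)).Nonempty := (Set.range_nonempty b).convexHull
    simp [hw, Set.zero_smul_set hne]
  · have hpos : (0 : ℝ) < ((∑ i, w i : ℕ) : ℝ) := by exact_mod_cast h
    rw [Set.mem_smul_set_iff_inv_smul_mem₀ hpos.ne', Finset.smul_sum]
    simp only [smul_smul]
    refine (convex_convexHull ℝ _).sum_mem (fun i _ => by positivity) ?_
      (fun i _ => subset_convexHull ℝ _ (Set.mem_range_self i))
    rw [← Finset.mul_sum, ← Nat.cast_sum, inv_mul_cancel₀ hpos.ne']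

/-- Rounding down the weights of a point of `s • H` (chosen by Carathéodory's theorem) loses total
weight less than `finrank ℝ E + 1`. -/
theorem exists_natCast_smul_add_of_mem_smul_convexHull {E ι : Type*} [AddCommGroup E]
    [Module ℝ E] [FiniteDimensional ℝ E] [Fintype ι] (b : ι → E) (C : Submodule NNReal E)
    (hb : ∀ i, b i ∈ C) {s : ℝ} (hs : 0 ≤ s) {v : E} (hv : v ∈ s • convexHull ℝ (Set.range b)) :
    ∃ w : ι → ℕ, s - Module.finrank ℝ E < ((∑ i, w i : ℕ) : ℝ) + 1 ∧
      ∃ u ∈ C, v = (∑ i, (w i : ℝ) • b i) + u := by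
  classical
  obtain ⟨x, hx, rfl⟩ := hv
  obtain ⟨κ, _, z, c, hz, hind, hc, hsum, rfl⟩ := eq_pos_convex_span_of_mem_convexHull hx
  choose f hf using fun k => hz (Set.mem_range_self k)
  have hcard : (Fintype.card κ : ℝ) ≤ Module.finrank ℝ E + 1 := by
    exact_mod_cast hind.card_le_finrank_succ.trans
      (Nat.add_le_add_right (Submodule.finrank_le _) 1)
  have hκ : (Finset.univ : Finset κ).Nonempty := by
    rw [Finset.nonempty_iff_ne_empty]
    intro h
    simp [h] at hsum
  have hsum' : ∑ k, s * c k = s := by rw [← Finset.mul_sum, hsum, mul_one]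
  refine ⟨fun i => ∑ k with f k = i, ⌊s * c k⌋₊, ?_,
    ∑ k, (s * c k - (⌊s * c k⌋₊ : ℝ)) • b (f k), ?_, ?_⟩
  · beta_reduce
    rw [Finset.sum_fiberwise Finset.univ f fun k => ⌊s * c k⌋₊]
    have h : ∑ k, s * c k < ∑ k, ((⌊s * c k⌋₊ : ℝ) + 1) :=
      Finset.sum_lt_sum_of_nonempty hκ fun k _ => Nat.lt_floor_add_one _
    rw [hsum', Finset.sum_add_distrib] at h
    simp only [Finset.sum_const, Finset.card_univ, nsmul_eq_mul, mul_one] at h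
    push_cast
    linarith
  · refine C.sum_mem fun k _ => ?_
    have h : (0 : ℝ) ≤ s * c k - (⌊s * c k⌋₊ : ℝ) :=
      sub_nonneg.2 (Nat.floor_le (mul_nonneg hs (hc k).le))
    exact C.smul_mem (⟨_, h⟩ : NNReal) (hb (f k))
  · have h : ∑ i, ((∑ k with f k = i, ⌊s * c k⌋₊ : ℕ) : ℝ) • b i
        = ∑ k, (⌊s * c k⌋₊ : ℝ) • b (f k) := by
      rw [← Finset.sum_fiberwise Finset.univ f]
      refine Finset.sum_congr rfl fun i _ => ?_
      rw [Nat.cast_sum, Finset.sum_smul]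
      refine Finset.sum_congr rfl fun k hk => ?_
      rw [(Finset.mem_filter.1 hk).2]
    beta_reduce
    rw [h, ← Finset.sum_add_distrib, Finset.smul_sum]
    refine Finset.sum_congr rfl fun k _ => ?_
    rw [← add_smul, add_sub_cancel, ← hf k, smul_smul]

theorem semigroup_hull_lemma {d : ℕ} (S : AddSubmonoid (Fin d → ℤ)) (hfg : S.FG)
    (hgen : AddSubgroup.closure (S : Set (Fin d → ℤ)) = ⊤)
    (r : ℕ) (hr : 0 < r) (a : Fin r → Fin d → ℤ) (ha : ∀ i, a i ∈ S) :
    -- `σ` is the convex cone generated by `S` in `ℝ^d`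
    ∀ σ : Set (Fin d → ℝ),
      σ = (Submodule.span NNReal (castR '' (S : Set (Fin d → ℤ))) : Set (Fin d → ℝ)) →
    ∀ H : Set (Fin d → ℝ), H = convexHull ℝ (Set.range fun i => castR (a i)) →
    -- (a)
    ((∀ n : ℕ, ∀ w : Fin r → ℕ, (∑ i, w i) = n → ∀ u ∈ σ,
        (∑ i, (w i : ℝ) • castR (a i)) + u ∈ (n : ℝ) • H + σ) ∧
    -- (b)
    (∀ s : ℝ, 0 < s → ∀ v ∈ s • H,
        ∃ w : Fin r → ℕ, (⌊s - (d : ℝ)⌋ ≤ ((∑ i, w i : ℕ) : ℤ)) ∧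
          ∃ u ∈ σ, v = (∑ i, (w i : ℝ) • castR (a i)) + u)) := by
  rintro σ rfl H rfl
  have : Nonempty (Fin r) := ⟨⟨0, hr⟩⟩
  refine ⟨?_, fun s hs v hv => ?_⟩
  · rintro n w rfl u hu
    exact Set.add_mem_add
      (sum_natCast_smul_mem_smul_convexHull (fun i => castR (a i)) w) hu
  · obtain ⟨w, hw, u, hu, rfl⟩ := exists_natCast_smul_add_of_mem_smul_convexHull
      (fun i => castR (a i)) _
      (fun i => Submodule.subset_span (Set.mem_image_of_mem castR (ha i))) hs.le hv
    rw [Module.finrank_fin_fun] at hw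
    refine ⟨w, Int.lt_add_one_iff.1 (Int.floor_lt.2 ?_), u, hu, rfl⟩
    exact_mod_cast hw
end

section
/- Let k be a field of prime characteristic p > 0, let σ^∨ = {v ∈ ℝ^d : ⟨cᵢ, v⟩ ≥ 0 for i = 1,…,n} for given c₁,…,cₙ ∈ ℤ^d, let S = σ^∨ ∩ ℤ^d (assumed to generate ℤ^d as a group), and let R = k[S] be the monoid algebra with monomials x^v for v ∈ S. Let 𝒜, ℬ ⊆ S be finite, 𝔞 = (x^a : a ∈ 𝒜), I = (x^b : b ∈ ℬ), H the convex hull of 𝒜 in ℝ^d, and t > 0 a real number. Then for v ∈ S: (a) x^v ∈ I^{F𝔞ᵗ} if and only if x^v ∈ I^{*𝔞ᵗ}, if and only if v + tH ⊆ ℬ + σ^∨; (b) x^v ∈ ^{𝔞ᵗ}I* if and only if v + tH ⊆ ℬ + tH + σ^∨; (c) if x^v ∈ ^{𝔞ᵗ}I^F then v + tH ⊆ ℬ + tH + σ^∨; and (d) if there exists a real s > t with v + tH ⊆ ℬ + sH + σ^∨, then x^v ∈ ^{𝔞ᵗ}I^F. -/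
open Ideal Filter
open scoped Pointwise

/-- The rational polyhedral cone `σ^∨ ⊆ ℝ^d` cut out by the linear functionals `⟨cᵢ, -⟩`. -/
def coneOf {d n : ℕ} (c : Fin n → Fin d → ℤ) : Set (Fin d → ℝ) :=
  {v | ∀ i, 0 ≤ ∑ j, (c i j : ℝ) * v j}

/-- The affine semigroup `S = σ^∨ ∩ ℤ^d` of lattice points of the cone. -/
def latticePoints {d n : ℕ} (c : Fin n → Fin d → ℤ) : AddSubmonoid (Fin d → ℤ) where
  carrier := {v | ∀ i, 0 ≤ ∑ j, c i j * v j}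
  zero_mem' := by intro i; simp
  add_mem' := by
    intro a b ha hb i
    have h := add_nonneg (ha i) (hb i)
    simpa [mul_add, Finset.sum_add_distrib] using h

section MonomialIdeals

variable {k M : Type*} [Field k] [AddCommMonoid M]

/-- The sums of `N` elements of `s`, repetitions allowed. -/
def sumsOfLength (s : Set M) (N : ℕ) : Set M :=
  {u | ∃ m : Multiset M, m.card = N ∧ (∀ a ∈ m, a ∈ s) ∧ m.sum = u}

lemma sumsOfLength_zero (s : Set M) : sumsOfLength s 0 = {0} := by
  ext u
  constructor
  · rintro ⟨m, hm, -, rfl⟩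
    simp [Multiset.card_eq_zero.mp hm]
  · rintro rfl
    exact ⟨0, by simp⟩

lemma sumsOfLength_succ (s : Set M) (N : ℕ) :
    sumsOfLength s (N + 1) = sumsOfLength s N + s := by
  ext u
  constructor
  · rintro ⟨m, hm, hs, rfl⟩
    obtain ⟨a, ha⟩ := Multiset.card_pos_iff_exists_mem.mp (show 0 < m.card by omega)
    obtain ⟨m', rfl⟩ := Multiset.exists_cons_of_mem ha
    refine Set.mem_add.mpr
      ⟨m'.sum, ⟨m', by simpa using hm, fun b hb => hs b ?_, rfl⟩, a, hs a ha, ?_⟩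
    · exact Multiset.mem_cons_of_mem hb
    · rw [Multiset.sum_cons, add_comm]
  · rintro ⟨_, ⟨m, hm, hs, rfl⟩, a, ha, rfl⟩
    refine ⟨a ::ₘ m, by simp [hm], ?_, ?_⟩
    · intro b hb
      rcases Multiset.mem_cons.mp hb with rfl | hb
      exacts [ha, hs b hb]
    · simp [add_comm]

lemma of'_add (u v : M) :
    AddMonoidAlgebra.of' k M (u + v) = AddMonoidAlgebra.of' k M u * AddMonoidAlgebra.of' k M v := by
  simp [AddMonoidAlgebra.of'_apply, AddMonoidAlgebra.single_mul_single]

lemma of'_nsmul (q : ℕ) (v : M) :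
    AddMonoidAlgebra.of' k M (q • v) = AddMonoidAlgebra.of' k M v ^ q := by
  simp [AddMonoidAlgebra.of'_apply, AddMonoidAlgebra.single_pow]

lemma span_of'_mul (s t : Set M) :
    Ideal.span (AddMonoidAlgebra.of' k M '' s) * Ideal.span (AddMonoidAlgebra.of' k M '' t) =
      Ideal.span (AddMonoidAlgebra.of' k M '' (s + t)) := by
  rw [Ideal.span_mul_span']
  congr 1
  exact (Set.image_image2_distrib of'_add).symm

lemma span_of'_pow (s : Set M) (N : ℕ) :
    Ideal.span (AddMonoidAlgebra.of' k M '' s) ^ N =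
      Ideal.span (AddMonoidAlgebra.of' k M '' sumsOfLength s N) := by
  induction N with
  | zero =>
    rw [pow_zero, sumsOfLength_zero, Set.image_singleton, AddMonoidAlgebra.of'_apply,
      ← AddMonoidAlgebra.one_def, Ideal.span_singleton_one, Ideal.one_eq_top]
  | succ N ih => rw [pow_succ, ih, span_of'_mul, sumsOfLength_succ]

lemma fbp_span_of' (p : ℕ) [Fact p.Prime] [CharP k p] (s : Set M) (e : ℕ) :
    fbp (Ideal.span (AddMonoidAlgebra.of' k M '' s)) (p ^ e) =
      Ideal.span (AddMonoidAlgebra.of' k M '' ((fun b => p ^ e • b) '' s)) := by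
  have : CharP (AddMonoidAlgebra k M) p := charP_of_injective_algebraMap' k p
  have h : fbp (Ideal.span (AddMonoidAlgebra.of' k M '' s)) (p ^ e) =
      Ideal.map (iterateFrobenius (AddMonoidAlgebra k M) p e)
        (Ideal.span (AddMonoidAlgebra.of' k M '' s)) := rfl
  rw [h, Ideal.map_span, Set.image_image, Set.image_image]
  simp only [iterateFrobenius_def, of'_nsmul]

lemma exists_add_eq_of_mul_of'_mem_span [IsCancelAdd M] {T : Set M} {f : AddMonoidAlgebra k M}
    {w u : M} (hw : w ∈ f.coeff.support)
    (h : f * AddMonoidAlgebra.of' k M u ∈ Ideal.span (AddMonoidAlgebra.of' k M '' T)) :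
    ∃ m ∈ T, ∃ d, w + u = d + m := by
  refine AddMonoidAlgebra.mem_ideal_span_of'_image.mp h _ ?_
  rw [AddMonoidAlgebra.of'_apply, AddMonoidAlgebra.support_coeff_mul_single _ _ (by simp)]
  exact Finset.mem_map_of_mem (addRightEmbedding u) hw

lemma of'_mul_mem_span_of_forall {T U : Set M} {w : M}
    (h : ∀ u ∈ U, ∃ m ∈ T, ∃ d, w + u = d + m) {y : AddMonoidAlgebra k M}
    (hy : y ∈ Ideal.span (AddMonoidAlgebra.of' k M '' U)) :
    AddMonoidAlgebra.of' k M w * y ∈ Ideal.span (AddMonoidAlgebra.of' k M '' T) := by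
  induction hy using Submodule.span_induction with
  | mem y hy =>
    obtain ⟨u, hu, rfl⟩ := hy
    obtain ⟨m, hm, d, hd⟩ := h u hu
    rw [← of'_add, hd, of'_add]
    exact Ideal.mul_mem_left _ _ (Ideal.subset_span ⟨m, hm, rfl⟩)
  | zero => simp
  | add x y _ _ hx hy => rw [mul_add]; exact add_mem hx hy
  | smul r y _ hy => rw [smul_eq_mul, mul_left_comm]; exact Ideal.mul_mem_left _ _ hy

lemma of'_mem_Rcirc [IsCancelAdd M] (w : M) :
    AddMonoidAlgebra.of' k M w ∈ Rcirc (AddMonoidAlgebra k M) := by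
  intro P hP hw
  refine notMem_nonZeroDivisors_of_mem_mem_minimalPrimes hw hP ?_
  rw [mem_nonZeroDivisors_iff_right]
  intro f hf
  have h := AddMonoidAlgebra.support_coeff_mul_single f (1 : k) (by simp) w
  rw [← AddMonoidAlgebra.of'_apply, hf] at h
  simpa [eq_comm] using h

lemma exists_mem_support_of_mem_Rcirc {f : AddMonoidAlgebra k M}
    (hf : f ∈ Rcirc (AddMonoidAlgebra k M)) : ∃ w, w ∈ f.coeff.support := by
  by_contra! h
  have h0 : f = 0 := by
    have : f.coeff.support = ∅ := Finset.eq_empty_of_forall_notMem h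
    simpa using this
  obtain ⟨P, hP⟩ := Ideal.nonempty_minimalPrimes (bot_ne_top (α := Ideal (AddMonoidAlgebra k M)))
  exact hf P hP (h0 ▸ P.zero_mem)

end MonomialIdeals

section Cone

variable {d n : ℕ} {c : Fin n → Fin d → ℤ}

lemma coneOf_add {x y : Fin d → ℝ} (hx : x ∈ coneOf c) (hy : y ∈ coneOf c) : x + y ∈ coneOf c := by
  intro i
  simpa [mul_add, Finset.sum_add_distrib] using add_nonneg (hx i) (hy i)

lemma coneOf_smul {r : ℝ} (hr : 0 ≤ r) {x : Fin d → ℝ} (hx : x ∈ coneOf c) :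
    r • x ∈ coneOf c := by
  intro i
  have := mul_nonneg hr (hx i)
  rw [Finset.mul_sum] at this
  simpa [mul_left_comm] using this

lemma zero_mem_coneOf : (0 : Fin d → ℝ) ∈ coneOf c := fun i => by simp

lemma coneOf_sum {ι : Type*} {s : Finset ι} {f : ι → Fin d → ℝ} (h : ∀ a ∈ s, f a ∈ coneOf c) :
    ∑ a ∈ s, f a ∈ coneOf c :=
  Finset.sum_induction f (· ∈ coneOf c) (fun _ _ => coneOf_add) zero_mem_coneOf h

lemma convex_coneOf (c : Fin n → Fin d → ℤ) : Convex ℝ (coneOf c) :=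
  fun _ hx _ hy _ _ ha hb _ => coneOf_add (coneOf_smul ha hx) (coneOf_smul hb hy)

lemma isClosed_coneOf (c : Fin n → Fin d → ℤ) : IsClosed (coneOf c) := by
  have : coneOf c = ⋂ i, {v : Fin d → ℝ | 0 ≤ ∑ j, (c i j : ℝ) * v j} := by
    ext; simp [coneOf]
  rw [this]
  exact isClosed_iInter fun i => isClosed_le continuous_const (by fun_prop)

/-- The embedding of the lattice points of the cone into `ℝ^d`, as an additive map. -/
def latticeEmb (c : Fin n → Fin d → ℤ) : latticePoints c →+ (Fin d → ℝ) where
  toFun u := castR (u : Fin d → ℤ)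
  map_zero' := by ext; simp [castR]
  map_add' u v := by ext; simp [castR]

lemma latticeEmb_injective (c : Fin n → Fin d → ℤ) : Function.Injective (latticeEmb c) := by
  intro u v h
  ext j
  have hj : ((u : Fin d → ℤ) j : ℝ) = (v : Fin d → ℤ) j := congrFun h j
  exact_mod_cast hj

lemma castR_mem_coneOf_iff {v : Fin d → ℤ} : castR v ∈ coneOf c ↔ v ∈ latticePoints c := by
  refine forall_congr' fun i => ?_
  simp only [castR]
  exact_mod_cast Iff.rfl

lemma latticeEmb_mem_coneOf (u : latticePoints c) : latticeEmb c u ∈ coneOf c :=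
  castR_mem_coneOf_iff.mpr u.2

lemma latticeEmb_sub_mem_coneOf_iff {x y : latticePoints c} :
    latticeEmb c x - latticeEmb c y ∈ coneOf c ↔ ∃ d, x = d + y := by
  constructor
  · intro h
    have h' : castR ((x : Fin d → ℤ) - (y : Fin d → ℤ)) ∈ coneOf c := by
      convert h using 1
      ext j
      simp [castR, latticeEmb]
    exact ⟨⟨_, castR_mem_coneOf_iff.mp h'⟩, by ext; simp⟩
  · rintro ⟨d, rfl⟩
    simpa using latticeEmb_mem_coneOf d

lemma convexHull_subset_coneOf (𝒜 : Finset (latticePoints c)) :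
    convexHull ℝ (latticeEmb c '' 𝒜) ⊆ coneOf c :=
  convexHull_min (by rintro _ ⟨u, -, rfl⟩; exact latticeEmb_mem_coneOf u) (convex_coneOf c)

lemma exists_weights_of_mem_convexHull {𝒜 : Finset (latticePoints c)} {h : Fin d → ℝ}
    (hh : h ∈ convexHull ℝ (latticeEmb c '' 𝒜)) :
    ∃ w : latticePoints c → ℝ, (∀ a ∈ 𝒜, 0 ≤ w a) ∧ ∑ a ∈ 𝒜, w a = 1 ∧
      ∑ a ∈ 𝒜, w a • latticeEmb c a = h := by
  classical
  rw [← Finset.coe_image, Finset.mem_convexHull'] at hh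
  obtain ⟨w, hw, h1, h2⟩ := hh
  refine ⟨w ∘ latticeEmb c, fun a ha => hw _ (Finset.mem_image_of_mem _ ha), ?_, ?_⟩
  · rwa [Finset.sum_image (latticeEmb_injective c).injOn] at h1
  · rwa [Finset.sum_image (latticeEmb_injective c).injOn] at h2

lemma exists_mem_convexHull_of_mem_sumsOfLength {𝒜 : Finset (latticePoints c)} {N : ℕ}
    {u : latticePoints c} (hu : u ∈ sumsOfLength (𝒜 : Set (latticePoints c)) N) (hN : 0 < N)
    {r : ℝ} (hr : r ≤ N) :
    ∃ h ∈ convexHull ℝ (latticeEmb c '' 𝒜), latticeEmb c u - r • h ∈ coneOf c := by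
  classical
  obtain ⟨m, hm, hs, rfl⟩ := hu
  have hsub : m.toFinset ⊆ 𝒜 := fun a ha => hs a (Multiset.mem_toFinset.mp ha)
  have hN' : (N : ℝ) ≠ 0 := by positivity
  have hmem : (∑ a ∈ 𝒜, ((m.count a : ℝ) / N) • latticeEmb c a) ∈
      convexHull ℝ (latticeEmb c '' 𝒜) := by
    refine (convex_convexHull ℝ _).sum_mem (fun a _ => by positivity) ?_
      (fun a ha => subset_convexHull ℝ _ ⟨a, ha, rfl⟩)
    rw [← Finset.sum_div, div_eq_one_iff_eq hN', ← hm]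
    exact_mod_cast Multiset.sum_count_eq_card fun a ha => hs a ha
  refine ⟨_, hmem, ?_⟩
  have hsum : latticeEmb c m.sum =
      (N : ℝ) • ∑ a ∈ 𝒜, ((m.count a : ℝ) / N) • latticeEmb c a := by
    rw [Finset.sum_multiset_count_of_subset m 𝒜 hsub, map_sum, Finset.smul_sum]
    refine Finset.sum_congr rfl fun a _ => ?_
    rw [map_nsmul, smul_smul, mul_div_cancel₀ _ hN', Nat.cast_smul_eq_nsmul]
  rw [hsum, ← sub_smul]
  exact coneOf_smul (sub_nonneg.mpr hr) (convexHull_subset_coneOf 𝒜 hmem)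

lemma exists_mem_sumsOfLength_of_le_sum_floor {𝒜 : Finset (latticePoints c)} {N : ℕ}
    {w : latticePoints c → ℝ} (hw : ∀ a ∈ 𝒜, 0 ≤ w a) (hN : N ≤ ∑ a ∈ 𝒜, ⌊w a⌋₊) :
    ∃ u ∈ sumsOfLength (𝒜 : Set (latticePoints c)) N,
      ∑ a ∈ 𝒜, w a • latticeEmb c a - latticeEmb c u ∈ coneOf c := by
  classical
  set big : Multiset (latticePoints c) := ∑ a ∈ 𝒜, Multiset.replicate ⌊w a⌋₊ a with hbig
  have hcard : big.card = ∑ a ∈ 𝒜, ⌊w a⌋₊ := by simp [hbig]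
  have hmem : ∀ b ∈ big, b ∈ 𝒜 := by
    intro b hb
    obtain ⟨a, ha, hb⟩ := Multiset.mem_sum.mp hb
    rwa [Multiset.eq_of_mem_replicate hb]
  obtain ⟨m, hm⟩ : ∃ m, m ∈ Multiset.powersetCard N big := by
    refine Multiset.card_pos_iff_exists_mem.mp ?_
    rw [Multiset.card_powersetCard]
    exact Nat.choose_pos (hcard ▸ hN)
  obtain ⟨hle, hmN⟩ := Multiset.mem_powersetCard.mp hm
  refine ⟨m.sum, ⟨m, hmN, fun a ha => hmem a (Multiset.mem_of_le hle ha), rfl⟩, ?_⟩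
  have hbs : latticeEmb c big.sum = ∑ a ∈ 𝒜, (⌊w a⌋₊ : ℝ) • latticeEmb c a := by
    have : big.sum = ∑ a ∈ 𝒜, ⌊w a⌋₊ • a := by
      rw [hbig, ← Multiset.coe_sumAddMonoidHom, map_sum]
      simp
    rw [this, map_sum]
    simp only [map_nsmul, Nat.cast_smul_eq_nsmul]
  obtain ⟨m', hm'⟩ := Multiset.le_iff_exists_add.mp hle
  have h1 : latticeEmb c big.sum - latticeEmb c m.sum ∈ coneOf c := by
    rw [hm', Multiset.sum_add, map_add, add_sub_cancel_left]
    exact latticeEmb_mem_coneOf _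
  have h2 : ∑ a ∈ 𝒜, w a • latticeEmb c a - latticeEmb c big.sum ∈ coneOf c := by
    rw [hbs, ← Finset.sum_sub_distrib]
    refine coneOf_sum fun a ha => ?_
    rw [← sub_smul]
    exact coneOf_smul (sub_nonneg.mpr (Nat.floor_le (hw a ha))) (latticeEmb_mem_coneOf a)
  simpa using coneOf_add h2 h1

lemma exists_mem_sumsOfLength_ceil {𝒜 : Finset (latticePoints c)} {h : Fin d → ℝ}
    (hh : h ∈ convexHull ℝ (latticeEmb c '' 𝒜)) {r : ℝ} (hr : 0 ≤ r) :
    ∃ u ∈ sumsOfLength (𝒜 : Set (latticePoints c)) ⌈r⌉₊,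
      r • h + latticeEmb c (∑ a ∈ 𝒜, a) - latticeEmb c u ∈ coneOf c := by
  obtain ⟨w, hw, h1, rfl⟩ := exists_weights_of_mem_convexHull hh
  obtain ⟨u, hu, hu'⟩ := exists_mem_sumsOfLength_of_le_sum_floor (𝒜 := 𝒜) (N := ⌈r⌉₊)
    (w := fun a => r * w a + 1) (fun a ha => by have := hw a ha; positivity) (by
      refine Nat.ceil_le.mpr ?_
      calc r = ∑ a ∈ 𝒜, r * w a := by rw [← Finset.mul_sum, h1, mul_one]
        _ ≤ ∑ a ∈ 𝒜, (⌊r * w a + 1⌋₊ : ℝ) := Finset.sum_le_sum fun a ha => by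
          have := Nat.lt_floor_add_one (r * w a + 1)
          linarith
        _ = _ := by push_cast; rfl)
  refine ⟨u, hu, ?_⟩
  convert hu' using 2
  rw [map_sum, Finset.smul_sum, ← Finset.sum_add_distrib]
  exact Finset.sum_congr rfl fun a _ => by module

lemma exists_mem_sumsOfLength_of_add_card_le {𝒜 : Finset (latticePoints c)} {h : Fin d → ℝ}
    (hh : h ∈ convexHull ℝ (latticeEmb c '' 𝒜)) {r : ℝ} {N : ℕ} (hr : (N : ℝ) + 𝒜.card ≤ r) :
    ∃ u ∈ sumsOfLength (𝒜 : Set (latticePoints c)) N, r • h - latticeEmb c u ∈ coneOf c := by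
  obtain ⟨w, hw, h1, rfl⟩ := exists_weights_of_mem_convexHull hh
  have hr0 : 0 ≤ r := le_trans (by positivity) hr
  obtain ⟨u, hu, hu'⟩ := exists_mem_sumsOfLength_of_le_sum_floor (𝒜 := 𝒜) (N := N)
    (w := fun a => r * w a) (fun a ha => by have := hw a ha; positivity) (by
      have h2 : ∑ a ∈ 𝒜, (r * w a - 1) ≤ ∑ a ∈ 𝒜, (⌊r * w a⌋₊ : ℝ) :=
        Finset.sum_le_sum fun a ha => (Nat.sub_one_lt_floor _).le
      rw [Finset.sum_sub_distrib, ← Finset.mul_sum, h1] at h2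
      have h3 : (N : ℝ) ≤ ∑ a ∈ 𝒜, (⌊r * w a⌋₊ : ℝ) := by
        simp only [Finset.sum_const, nsmul_eq_mul, mul_one] at h2
        linarith
      exact_mod_cast h3)
  refine ⟨u, hu, ?_⟩
  convert hu' using 2
  rw [Finset.smul_sum]
  exact Finset.sum_congr rfl fun a _ => by module

lemma IsClosed.mem_of_forall_add_inv_pow_smul_mem {E : Type*} [AddCommGroup E] [Module ℝ E]
    [TopologicalSpace E] [ContinuousAdd E] [ContinuousSMul ℝ E] {X : Set E} (hX : IsClosed X)
    {x z : E} {q : ℝ} (hq : 1 < q) {e₀ : ℕ}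
    (h : ∀ e : ℕ, e₀ ≤ e → x + (q ^ e)⁻¹ • z ∈ X) : x ∈ X := by
  have ht : Tendsto (fun e : ℕ => x + (q ^ e)⁻¹ • z) atTop (nhds x) := by
    have h0 : Tendsto (fun e : ℕ => (q ^ e)⁻¹) atTop (nhds 0) :=
      (tendsto_pow_atTop_atTop_of_one_lt hq).inv_tendsto_atTop
    simpa using (h0.smul_const z).const_add x
  exact hX.mem_of_tendsto ht (eventually_atTop.mpr ⟨e₀, h⟩)

end Cone

section Closures

variable {d n : ℕ} {k : Type*} [Field k] {p : ℕ} [Fact p.Prime] [CharP k p]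
  {c : Fin n → Fin d → ℤ} {𝒜 ℬ : Finset (latticePoints c)} {t : ℝ} {v : latticePoints c}

variable (k) in
/-- The ideal of `k[S]` generated by the monomials with exponents in `s`. -/
noncomputable def monomialIdeal (s : Finset (latticePoints c)) :
    Ideal (AddMonoidAlgebra k (latticePoints c)) :=
  Ideal.span (AddMonoidAlgebra.of' k (latticePoints c) '' (s : Set (latticePoints c)))

lemma mem_points_add_coneOf {x : Fin d → ℝ} :
    x ∈ latticeEmb c '' ℬ + coneOf c ↔ ∃ b ∈ ℬ, x - latticeEmb c b ∈ coneOf c := by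
  constructor
  · rintro ⟨_, ⟨b, hb, rfl⟩, s, hs, rfl⟩
    exact ⟨b, hb, by simpa using hs⟩
  · rintro ⟨b, hb, h⟩
    exact ⟨_, ⟨b, hb, rfl⟩, _, h, add_sub_cancel _ _⟩

lemma mem_points_add_hull_add_coneOf {H : Set (Fin d → ℝ)} {s : ℝ} {x : Fin d → ℝ} :
    x ∈ latticeEmb c '' ℬ + s • H + coneOf c ↔
      ∃ b ∈ ℬ, ∃ h ∈ H, x - latticeEmb c b - s • h ∈ coneOf c := by
  constructor
  · rintro ⟨_, ⟨_, ⟨b, hb, rfl⟩, _, ⟨h, hh, rfl⟩, rfl⟩, s, hs, rfl⟩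
    refine ⟨b, hb, h, hh, ?_⟩
    convert hs using 1
    module
  · rintro ⟨b, hb, h, hh, hx⟩
    exact ⟨_, ⟨_, ⟨b, hb, rfl⟩, _, ⟨h, hh, rfl⟩, rfl⟩, _, hx, by module⟩

lemma ceil_mul_pow_pos (ht : 0 < t) (e : ℕ) : 0 < ⌈t * (p : ℝ) ^ e⌉₊ := by
  have : 0 < (p : ℝ) := by exact_mod_cast (Fact.out : p.Prime).pos
  exact Nat.ceil_pos.mpr (by positivity)

lemma monomialIdeal_pow (s : Finset (latticePoints c)) (N : ℕ) :
    monomialIdeal k s ^ N =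
      Ideal.span (AddMonoidAlgebra.of' k (latticePoints c) '' sumsOfLength s N) :=
  span_of'_pow _ _

lemma fbp_monomialIdeal (s : Finset (latticePoints c)) (e : ℕ) :
    fbp (monomialIdeal k s) (p ^ e) =
      Ideal.span (AddMonoidAlgebra.of' k (latticePoints c) '' ((fun b => p ^ e • b) '' s)) :=
  fbp_span_of' p _ _

lemma add_smul_mem_of_mem_HYTightCl (ht : 0 < t)
    (hx : AddMonoidAlgebra.of' k _ v ∈ HYTightCl p (monomialIdeal k ℬ) (monomialIdeal k 𝒜) t)
    {h : Fin d → ℝ} (hh : h ∈ convexHull ℝ (latticeEmb c '' 𝒜)) :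
    latticeEmb c v + t • h ∈ latticeEmb c '' ℬ + coneOf c := by
  have hp : 1 < (p : ℝ) := by exact_mod_cast (Fact.out : p.Prime).one_lt
  obtain ⟨f, hf, E, hE⟩ := hx
  obtain ⟨w, hw⟩ := exists_mem_support_of_mem_Rcirc hf
  have hclosed : IsClosed (latticeEmb c '' ℬ + coneOf c) :=
    (isClosed_coneOf c).add_left_of_isCompact (ℬ.finite_toSet.image _).isCompact
  refine hclosed.mem_of_forall_add_inv_pow_smul_mem hp (e₀ := E)
    (z := latticeEmb c w + latticeEmb c (∑ a ∈ 𝒜, a)) fun e he => ?_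
  have hq : 0 < (p : ℝ) ^ e := by positivity
  obtain ⟨u, hu, hu'⟩ := exists_mem_sumsOfLength_ceil hh (r := t * (p : ℝ) ^ e) (by positivity)
  have hmem := hE e he (AddMonoidAlgebra.of' k _ u)
    (by rw [monomialIdeal_pow]; exact Ideal.subset_span ⟨u, hu, rfl⟩)
  rw [fbp_monomialIdeal, ← of'_nsmul, mul_assoc, ← of'_add] at hmem
  obtain ⟨_, ⟨b, hb, rfl⟩, hd⟩ := exists_add_eq_of_mul_of'_mem_span hw hmem
  have hd' := latticeEmb_sub_mem_coneOf_iff.mpr hd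
  refine mem_points_add_coneOf.mpr ⟨b, hb, ?_⟩
  convert coneOf_smul (inv_nonneg.mpr hq.le) (coneOf_add hu' hd') using 1
  simp only [map_add, map_nsmul, ← Nat.cast_smul_eq_nsmul ℝ, Nat.cast_pow]
  match_scalars <;> field_simp
  ring

lemma mem_HYFrobCl_of_forall (ht : 0 < t)
    (hx : ∀ h ∈ convexHull ℝ (latticeEmb c '' 𝒜),
      latticeEmb c v + t • h ∈ latticeEmb c '' ℬ + coneOf c) :
    AddMonoidAlgebra.of' k _ v ∈ HYFrobCl p (monomialIdeal k ℬ) (monomialIdeal k 𝒜) t := by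
  refine ⟨0, fun e _ y hy => ?_⟩
  rw [monomialIdeal_pow] at hy
  rw [fbp_monomialIdeal, ← of'_nsmul]
  refine of'_mul_mem_span_of_forall (fun u hu => ?_) hy
  obtain ⟨h, hh, hu'⟩ :=
    exists_mem_convexHull_of_mem_sumsOfLength hu (ceil_mul_pow_pos ht e) (Nat.le_ceil _)
  obtain ⟨b, hb, hb'⟩ := mem_points_add_coneOf.mp (hx h hh)
  refine ⟨_, ⟨b, hb, rfl⟩, latticeEmb_sub_mem_coneOf_iff.mp ?_⟩
  convert coneOf_add hu' (coneOf_smul (r := (p : ℝ) ^ e) (by positivity) hb') using 1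
  simp only [map_add, map_nsmul, ← Nat.cast_smul_eq_nsmul ℝ, Nat.cast_pow]
  module

lemma add_smul_mem_of_mem_VTightCl (ht : 0 < t)
    (hx : AddMonoidAlgebra.of' k _ v ∈ VTightCl p (monomialIdeal k ℬ) (monomialIdeal k 𝒜) t)
    {h : Fin d → ℝ} (hh : h ∈ convexHull ℝ (latticeEmb c '' 𝒜)) :
    latticeEmb c v + t • h ∈
      latticeEmb c '' ℬ + t • convexHull ℝ (latticeEmb c '' 𝒜) + coneOf c := by
  have hp : 1 < (p : ℝ) := by exact_mod_cast (Fact.out : p.Prime).one_lt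
  obtain ⟨f, hf, E, hE⟩ := hx
  obtain ⟨w, hw⟩ := exists_mem_support_of_mem_Rcirc hf
  have hcompact : IsCompact (latticeEmb c '' ℬ + t • convexHull ℝ (latticeEmb c '' 𝒜)) :=
    (ℬ.finite_toSet.image _).isCompact.add
      (((𝒜.finite_toSet.image _).isCompact_convexHull ℝ).smul t)
  have hclosed := (isClosed_coneOf c).add_left_of_isCompact hcompact
  refine hclosed.mem_of_forall_add_inv_pow_smul_mem hp (e₀ := E)
    (z := latticeEmb c w + latticeEmb c (∑ a ∈ 𝒜, a)) fun e he => ?_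
  have hq : 0 < (p : ℝ) ^ e := by positivity
  obtain ⟨u, hu, hu'⟩ := exists_mem_sumsOfLength_ceil hh (r := t * (p : ℝ) ^ e) (by positivity)
  have hmem := hE e he (AddMonoidAlgebra.of' k _ u)
    (by rw [monomialIdeal_pow]; exact Ideal.subset_span ⟨u, hu, rfl⟩)
  rw [fbp_monomialIdeal, monomialIdeal_pow, span_of'_mul, ← of'_nsmul, mul_assoc,
    ← of'_add] at hmem
  obtain ⟨_, ⟨u₂, hu₂, _, ⟨b, hb, rfl⟩, rfl⟩, hd⟩ := exists_add_eq_of_mul_of'_mem_span hw hmem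
  obtain ⟨h₂, hh₂, hu₂'⟩ :=
    exists_mem_convexHull_of_mem_sumsOfLength hu₂ (ceil_mul_pow_pos ht e) (Nat.le_ceil _)
  have hd' := latticeEmb_sub_mem_coneOf_iff.mpr hd
  refine mem_points_add_hull_add_coneOf.mpr ⟨b, hb, h₂, hh₂, ?_⟩
  convert coneOf_smul (inv_nonneg.mpr hq.le) (coneOf_add (coneOf_add hu' hd') hu₂') using 1
  simp only [map_add, map_nsmul, ← Nat.cast_smul_eq_nsmul ℝ, Nat.cast_pow]
  match_scalars <;> field_simp <;> ring

lemma mem_VTightCl_of_forall (ht : 0 < t)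
    (hx : ∀ h ∈ convexHull ℝ (latticeEmb c '' 𝒜), latticeEmb c v + t • h ∈
      latticeEmb c '' ℬ + t • convexHull ℝ (latticeEmb c '' 𝒜) + coneOf c) :
    AddMonoidAlgebra.of' k _ v ∈ VTightCl p (monomialIdeal k ℬ) (monomialIdeal k 𝒜) t := by
  refine ⟨AddMonoidAlgebra.of' k _ (∑ a ∈ 𝒜, a), of'_mem_Rcirc _, 0, fun e _ y hy => ?_⟩
  rw [fbp_monomialIdeal, monomialIdeal_pow, span_of'_mul, ← of'_nsmul, ← of'_add]
  rw [monomialIdeal_pow] at hy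
  refine of'_mul_mem_span_of_forall (fun u hu => ?_) hy
  obtain ⟨h, hh, hu'⟩ :=
    exists_mem_convexHull_of_mem_sumsOfLength hu (ceil_mul_pow_pos ht e) (Nat.le_ceil _)
  obtain ⟨b, hb, h₂, hh₂, hb'⟩ := mem_points_add_hull_add_coneOf.mp (hx h hh)
  obtain ⟨u₂, hu₂, hu₂'⟩ :=
    exists_mem_sumsOfLength_ceil hh₂ (r := t * (p : ℝ) ^ e) (by positivity)
  refine ⟨_, Set.add_mem_add hu₂ ⟨b, hb, rfl⟩, latticeEmb_sub_mem_coneOf_iff.mp ?_⟩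
  convert coneOf_add (coneOf_add hu' hu₂')
    (coneOf_smul (r := (p : ℝ) ^ e) (by positivity) hb') using 1
  simp only [map_add, map_nsmul, ← Nat.cast_smul_eq_nsmul ℝ, Nat.cast_pow]
  module

lemma mem_VFrobCl_of_forall (ht : 0 < t) {s : ℝ} (hts : t < s)
    (hx : ∀ h ∈ convexHull ℝ (latticeEmb c '' 𝒜), latticeEmb c v + t • h ∈
      latticeEmb c '' ℬ + s • convexHull ℝ (latticeEmb c '' 𝒜) + coneOf c) :
    AddMonoidAlgebra.of' k _ v ∈ VFrobCl p (monomialIdeal k ℬ) (monomialIdeal k 𝒜) t := by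
  have hp : 1 < (p : ℝ) := by exact_mod_cast (Fact.out : p.Prime).one_lt
  obtain ⟨E, hE⟩ := eventually_atTop.mp
    ((tendsto_pow_atTop_atTop_of_one_lt hp).eventually_ge_atTop ((𝒜.card + 1) / (s - t)))
  refine ⟨E, fun e he y hy => ?_⟩
  rw [fbp_monomialIdeal, monomialIdeal_pow, span_of'_mul, ← of'_nsmul]
  rw [monomialIdeal_pow] at hy
  refine of'_mul_mem_span_of_forall (fun u hu => ?_) hy
  have hr : (⌈t * (p : ℝ) ^ e⌉₊ : ℝ) + 𝒜.card ≤ s * (p : ℝ) ^ e := by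
    have h1 := Nat.ceil_lt_add_one (show 0 ≤ t * (p : ℝ) ^ e by positivity)
    have h2 := (div_le_iff₀ (sub_pos.mpr hts)).mp (hE e he)
    linarith
  obtain ⟨h, hh, hu'⟩ :=
    exists_mem_convexHull_of_mem_sumsOfLength hu (ceil_mul_pow_pos ht e) (Nat.le_ceil _)
  obtain ⟨b, hb, h₂, hh₂, hb'⟩ := mem_points_add_hull_add_coneOf.mp (hx h hh)
  obtain ⟨u₂, hu₂, hu₂'⟩ := exists_mem_sumsOfLength_of_add_card_le hh₂ hr
  refine ⟨_, Set.add_mem_add hu₂ ⟨b, hb, rfl⟩, latticeEmb_sub_mem_coneOf_iff.mp ?_⟩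
  convert coneOf_add (coneOf_add hu' hu₂')
    (coneOf_smul (r := (p : ℝ) ^ e) (by positivity) hb') using 1
  simp only [map_add, map_nsmul, ← Nat.cast_smul_eq_nsmul ℝ, Nat.cast_pow]
  module

end Closures

lemma one_mem_Rcirc (R : Type*) [CommRing R] : (1 : R) ∈ Rcirc R :=
  fun _ hP h => hP.1.1.ne_top ((Ideal.eq_top_iff_one _).mpr h)

lemma HYFrobCl_subset_HYTightCl {R : Type*} [CommRing R] (p : ℕ) (I a : Ideal R) (t : ℝ) :
    HYFrobCl p I a t ⊆ HYTightCl p I a t := by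
  rintro x ⟨E, hE⟩
  exact ⟨1, one_mem_Rcirc R, E, by simpa using hE⟩

lemma VFrobCl_subset_VTightCl {R : Type*} [CommRing R] (p : ℕ) (I a : Ideal R) (t : ℝ) :
    VFrobCl p I a t ⊆ VTightCl p I a t := by
  rintro x ⟨E, hE⟩
  exact ⟨1, one_mem_Rcirc R, E, by simpa using hE⟩

theorem semigroup_ring_adjusted_closures {d n : ℕ} (k : Type*) [Field k]
    (p : ℕ) [Fact p.Prime] [CharP k p] (c : Fin n → Fin d → ℤ)
    (hgen : AddSubgroup.closure ((latticePoints c : Set (Fin d → ℤ))) = ⊤)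
    (𝒜 ℬ : Finset ↥(latticePoints c)) (t : ℝ) (ht : 0 < t)
    (v : ↥(latticePoints c)) :
    ∀ a I : Ideal (AddMonoidAlgebra k ↥(latticePoints c)),
      a = Ideal.span ((fun u : ↥(latticePoints c) =>
            AddMonoidAlgebra.of' k ↥(latticePoints c) u) '' (𝒜 : Set ↥(latticePoints c))) →
      I = Ideal.span ((fun u : ↥(latticePoints c) =>
            AddMonoidAlgebra.of' k ↥(latticePoints c) u) '' (ℬ : Set ↥(latticePoints c))) →
    ∀ H Bs : Set (Fin d → ℝ),
      H = convexHull ℝ ((fun u : ↥(latticePoints c) => castR (u : Fin d → ℤ)) ''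
            (𝒜 : Set ↥(latticePoints c))) →
      Bs = (fun u : ↥(latticePoints c) => castR (u : Fin d → ℤ)) ''
            (ℬ : Set ↥(latticePoints c)) →
    ∀ xv : AddMonoidAlgebra k ↥(latticePoints c),
      xv = AddMonoidAlgebra.of' k ↥(latticePoints c) v →
    -- (a)
    ((xv ∈ HYFrobCl p I a t ↔ xv ∈ HYTightCl p I a t) ∧
     (xv ∈ HYFrobCl p I a t ↔ castR (v : Fin d → ℤ) +ᵥ t • H ⊆ Bs + coneOf c) ∧
    -- (b)
     (xv ∈ VTightCl p I a t ↔ castR (v : Fin d → ℤ) +ᵥ t • H ⊆ Bs + t • H + coneOf c) ∧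
    -- (c)
     (xv ∈ VFrobCl p I a t → castR (v : Fin d → ℤ) +ᵥ t • H ⊆ Bs + t • H + coneOf c) ∧
    -- (d)
     ((∃ s : ℝ, t < s ∧ castR (v : Fin d → ℤ) +ᵥ t • H ⊆ Bs + s • H + coneOf c) →
        xv ∈ VFrobCl p I a t)) := by
  rintro _ _ rfl rfl _ _ rfl rfl _ rfl
  have key : ∀ X : Set (Fin d → ℝ),
      castR (v : Fin d → ℤ) +ᵥ t • convexHull ℝ (latticeEmb c '' 𝒜) ⊆ X ↔
        ∀ h ∈ convexHull ℝ (latticeEmb c '' 𝒜), latticeEmb c v + t • h ∈ X := by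
    intro X
    constructor
    · exact fun hX h hh => hX ⟨_, ⟨h, hh, rfl⟩, rfl⟩
    · rintro hX _ ⟨_, ⟨h, hh, rfl⟩, rfl⟩
      exact hX h hh
  refine ⟨⟨fun h => HYFrobCl_subset_HYTightCl _ _ _ _ h, fun h => ?_⟩, ⟨fun h => ?_, fun h => ?_⟩,
    ⟨fun h => ?_, fun h => ?_⟩, fun h => ?_, ?_⟩
  · exact mem_HYFrobCl_of_forall ht fun _ hh => add_smul_mem_of_mem_HYTightCl ht h hh
  · exact (key _).mpr fun _ hh =>
      add_smul_mem_of_mem_HYTightCl ht (HYFrobCl_subset_HYTightCl _ _ _ _ h) hh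
  · exact mem_HYFrobCl_of_forall ht ((key _).mp h)
  · exact (key _).mpr fun _ hh => add_smul_mem_of_mem_VTightCl ht h hh
  · exact mem_VTightCl_of_forall ht ((key _).mp h)
  · exact (key _).mpr fun _ hh =>
      add_smul_mem_of_mem_VTightCl ht (VFrobCl_subset_VTightCl _ _ _ _ h) hh
  · rintro ⟨s, hts, h⟩
    exact mem_VFrobCl_of_forall ht hts ((key _).mp h)
end
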